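/- There exist constants C₁ > 0 and C₂ > 0 (depending only on A and B) such that for every n ≥ 1 the error L_n of best uniform approximation of sgn(x) on I = [-A,-1] ∪ [1,B] by real polynomials of degree at most n satisfies C₁ · n^{-1/2} · e^{-ηn} ≤ L_n ≤ C₂ · n^{-1/2} · e^{-ηn}. -/

import Mathlib

open MeasureTheory Filter Set Real

/-- sign function: -1 for negative, 1 otherwise (only used on sets avoiding 0) -/
noncomputable def sgn (x : ℝ) : ℝ := if x < 0 then -1 else 1

/-- The error of best uniform approximation of sgn on [-A,-1] ∪ [1,B]
by real polynomials of degree at most n. -/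
noncomputable def bestErr (A B : ℝ) (n : ℕ) : ℝ :=
  sInf {e : ℝ | ∃ p : Polynomial ℝ, p.degree ≤ (n : ℕ) ∧
    e = sSup ((fun x => |sgn x - p.eval x|) '' (Icc (-A) (-1) ∪ Icc 1 B))}

/-- the weight w(x) = ((1−x²)(x+A)(B−x))^(−1/2) -/
noncomputable def wt (A B x : ℝ) : ℝ := 1 / Real.sqrt ((1 - x ^ 2) * (x + A) * (B - x))

/-- the critical point C of the Green function -/
noncomputable def Ccrit (A B : ℝ) : ℝ :=
  (∫ x in (-1 : ℝ)..1, x * wt A B x) / (∫ x in (-1 : ℝ)..1, wt A B x)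

/-- η = G(C,∞), the critical value of the Green function -/
noncomputable def eta (A B : ℝ) : ℝ :=
  ∫ x in (-1 : ℝ)..(Ccrit A B), (Ccrit A B - x) * wt A B x

namespace Fuchs
open Polynomial

/-- the quartic whose square root defines the elliptic curve -/
noncomputable def Rp (A B : ℝ) : ℝ[X] := (X + C A) * (X ^ 2 - 1) * (X - C B)

lemma Rp_eval (A B x : ℝ) : (Rp A B).eval x = (x + A) * (x ^ 2 - 1) * (x - B) := by
  simp [Rp]

lemma Rp_eq (A B : ℝ) : Rp A B = X ^ 4 + C (A - B) * X ^ 3 + C (-A * B - 1) * X ^ 2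
    + C (B - A) * X + C (A * B) := by
  simp only [Rp, map_sub, map_mul, map_neg, map_one]; ring

lemma Rp_natDegree (A B : ℝ) : (Rp A B).natDegree = 4 := by
  rw [Rp_eq]; compute_degree!

lemma Rp_monic (A B : ℝ) : (Rp A B).Monic := by
  rw [Rp_eq]; monicity!

lemma natDegree_sub_le'' {p q : ℝ[X]} {n : ℕ} (hp : p.natDegree ≤ n) (hq : q.natDegree ≤ n) :
    (p - q).natDegree ≤ n := (natDegree_sub_le_of_le hp hq).trans (by simp)

/-- polynomial part of `X^k * sqrt R` -/
lemma sqrt_approx (A B : ℝ) (k : ℕ) : ∃ V : ℝ[X], V.Monic ∧ V.natDegree = k + 2 ∧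
    (V ^ 2 - X ^ (2 * k) * Rp A B).natDegree ≤ k + 1 := by
  induction k with
  | zero =>
    refine ⟨X ^ 2 + C ((A - B) / 2) * X + C (((-A * B - 1) - (A - B) ^ 2 / 4) / 2), ?_, ?_, ?_⟩
    · monicity!
    · compute_degree!
    · set c := ((-A * B - 1) - (A - B) ^ 2 / 4) / 2 with hc
      have : (X ^ 2 + C ((A - B) / 2) * X + C c) ^ 2
          - X ^ (2 * 0) * Rp A B = C ((A-B) * c - (B - A)) * X + C (c ^ 2 - A * B) := by
        rw [Rp_eq]
        have h1 : (-A * B - 1) = 2 * c + (A-B)^2/4 := by rw [hc]; ring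
        have h2 : C (A - B) = 2 * C ((A-B)/2) := by
          rw [show (2:ℝ[X]) = C 2 from rfl, ← C_mul]; congr 1; ring
        rw [h1]
        have h3 : C (2 * c + (A-B)^2/4) = 2 * C c + C ((A-B)/2) ^ 2 := by
          rw [show (2:ℝ[X]) = C 2 from rfl, ← C_mul, ← C_pow, ← C_add]; congr 1; ring
        have h4 : C ((A-B) * c - (B - A)) = 2 * C ((A-B)/2) * C c - C (B - A) := by
          rw [show (2:ℝ[X]) = C 2 from rfl, ← C_mul, ← C_mul, ← C_sub]; congr 1; ring
        rw [h3, h4, h2, show C (c ^ 2 - A * B) = C c ^ 2 - C (A * B) by rw [C_sub, C_pow]]; ring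
      rw [this]
      compute_degree
  | succ k ih =>
    obtain ⟨V, hm, hd, hW⟩ := ih
    set W := V ^ 2 - X ^ (2 * k) * Rp A B with hWdef
    set c := -(W.coeff (k+1)) / 2 with hc
    have hXV : (X * V).natDegree = k + 3 := by
      rw [natDegree_X_mul hm.ne_zero, hd]
    refine ⟨X * V + C c, ?_, ?_, ?_⟩
    · apply (monic_X.mul hm).add_of_left
      rw [degree_eq_natDegree (monic_X.mul hm).ne_zero, hXV]
      exact lt_of_le_of_lt degree_C_le (by norm_cast; omega)
    · rw [natDegree_add_C, hXV]
    · have e : (X * V + C c) ^ 2 - X ^ (2 * (k + 1)) * Rp A B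
          = X ^ 2 * W + C (2 * c) * (X * V) + C (c ^ 2) := by
        rw [hWdef, C_mul, C_pow, show C (2:ℝ) = 2 from rfl]; ring
      rw [e]
      have hb : (X ^ 2 * W + C (2 * c) * (X * V) + C (c ^ 2)).natDegree ≤ k + 3 := by
        refine natDegree_add_le_of_degree_le (natDegree_add_le_of_degree_le ?_ ?_) ?_
        · refine (natDegree_mul_le).trans ?_
          rw [natDegree_X_pow]; omega
        · exact (natDegree_C_mul_le _ _).trans hXV.le
        · simp
      have hz : (X ^ 2 * W + C (2 * c) * (X * V) + C (c ^ 2)).coeff (k + 3) = 0 := by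
        have h1 : (X ^ 2 * W).coeff (k + 1 + 2) = W.coeff (k + 1) := coeff_X_pow_mul _ _ _
        have h2 : (X * V).coeff (k + 2 + 1) = 1 := by
          rw [coeff_X_mul]; rw [← hd]; exact hm
        simp only [coeff_add, coeff_C_mul]
        rw [show k + 3 = k + 1 + 2 from rfl, h1, show k + 1 + 2 = k + 2 + 1 from rfl, h2]
        rw [coeff_C_succ, hc]; ring
      have := natDegree_le_pred hb hz
      simpa using this

lemma Rp_neg {A B x : ℝ} (hA : 1 < A) (hx : x ∈ Ioo 1 B) : (Rp A B).eval x < 0 := by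
  rw [Rp_eval]
  have h1 := hx.1
  have h2 := hx.2
  apply mul_neg_of_pos_of_neg _ (by linarith)
  apply mul_pos <;> nlinarith

lemma pell_ne_zero {A B : ℝ} (hA : 1 < A) (hB : 1 < B) {P Q : ℝ[X]}
    (h : P ^ 2 - Rp A B * Q ^ 2 = 0) : P = 0 ∧ Q = 0 := by
  have key : ∀ x ∈ Ioo 1 B, P.eval x = 0 ∧ Q.eval x = 0 := by
    intro x hx
    have := congrArg (eval x) h
    simp only [eval_sub, eval_pow, eval_mul, eval_zero] at this
    have hR := Rp_neg hA hx
    have hP : P.eval x ^ 2 = 0 := by nlinarith [sq_nonneg (P.eval x), sq_nonneg (Q.eval x)]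
    have hQ : Q.eval x ^ 2 = 0 := by
      rw [hP] at this
      have : eval x (Rp A B) * eval x Q ^ 2 = 0 := by linarith
      exact (mul_eq_zero.1 this).resolve_left hR.ne
    exact ⟨by simpa using hP, by simpa using hQ⟩
  have inf : (Ioo 1 B).Infinite := Ioo_infinite hB
  constructor
  · exact eq_zero_of_infinite_isRoot P (inf.mono fun x hx => (key x hx).1)
  · exact eq_zero_of_infinite_isRoot Q (inf.mono fun x hx => (key x hx).2)

set_option maxHeartbeats 1000000 in
lemma pell_exists {A B : ℝ} (hA : 1 < A) (hB : 1 < B) (n : ℕ) (hn : 2 ≤ n) :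
    ∃ (P Q : ℝ[X]) (a b : ℝ), P ^ 2 - Rp A B * Q ^ 2 = C a * X + C b ∧
      ¬ (a = 0 ∧ b = 0) ∧ P.natDegree ≤ n ∧ (P.coeff n ≠ 0 ∨ (P.coeff (n-1) ≠ 0 ∧ a = 0)) := by
  obtain ⟨V, hm, hd, hW⟩ := sqrt_approx A B (2 * n)
  set W := V ^ 2 - X ^ (2 * (2 * n)) * Rp A B with hWdef
  let f : (degreeLT ℝ (n+1) × degreeLT ℝ (n-1)) →ₗ[ℝ] (Fin (2*n-1) → ℝ) :=
    LinearMap.pi fun i => (lcoeff ℝ (n + 2 + i)).comp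
      ((LinearMap.mulLeft ℝ (X ^ (2*n) : ℝ[X])).comp
        ((degreeLT ℝ (n+1)).subtype.comp (LinearMap.fst ℝ _ _)) -
      (LinearMap.mulRight ℝ V).comp ((degreeLT ℝ (n-1)).subtype.comp (LinearMap.snd ℝ _ _)))
  have fin1 : Module.finrank ℝ (degreeLT ℝ (n+1) × degreeLT ℝ (n-1)) = 2 * n := by
    have e1 := (degreeLTEquiv ℝ (n+1)).finrank_eq
    have e2 := (degreeLTEquiv ℝ (n-1)).finrank_eq
    have i1 : Module.Finite ℝ (degreeLT ℝ (n+1)) := Module.Finite.equiv (degreeLTEquiv ℝ (n+1)).symm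
    have i2 : Module.Finite ℝ (degreeLT ℝ (n-1)) := Module.Finite.equiv (degreeLTEquiv ℝ (n-1)).symm
    rw [Module.finrank_prod, e1, e2]; simp; omega
  obtain ⟨⟨⟨P, hP⟩, ⟨Q, hQ⟩⟩, hker, hne⟩ :=
    (Submodule.ne_bot_iff _).1 (LinearMap.ker_ne_bot_of_finrank_lt (f := f) (by
      rw [fin1]; simp; omega))
  rw [mem_degreeLT] at hP hQ
  have hPn : P.natDegree ≤ n := by
    rw [natDegree_le_iff_coeff_eq_zero]
    exact fun N hN => (degree_lt_iff_coeff_zero _ _).1 hP N hN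
  have hQn : Q.natDegree ≤ n - 2 := by
    rw [natDegree_le_iff_coeff_eq_zero]
    exact fun N hN => (degree_lt_iff_coeff_zero _ _).1 hQ N (by omega)
  have hPQ : ¬ (P = 0 ∧ Q = 0) := by
    rintro ⟨rfl, rfl⟩; exact hne rfl
  set Z := X ^ (2 * n) * P - Q * V with hZ
  have hZc : ∀ i : ℕ, i < 2 * n - 1 → Z.coeff (n + 2 + i) = 0 := by
    intro i hi
    have := congrFun (LinearMap.mem_ker.1 hker) ⟨i, hi⟩
    simpa [f, hZ] using this
  have hZn : Z.natDegree ≤ n + 1 := by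
    have h0 : Z.natDegree ≤ 3 * n := by
      refine natDegree_sub_le'' ?_ ?_
      · refine natDegree_mul_le.trans ?_
        rw [natDegree_X_pow]; omega
      · refine natDegree_mul_le.trans ?_
        rw [hd]; omega
    rw [natDegree_le_iff_coeff_eq_zero]
    intro N hN
    by_cases h : N ≤ 3 * n
    · have := hZc (N - (n + 2)) (by omega)
      rwa [show n + 2 + (N - (n+2)) = N by omega] at this
    · exact coeff_eq_zero_of_natDegree_lt (by omega)
  set D := P ^ 2 - Rp A B * Q ^ 2 with hD
  have hDne : D ≠ 0 := fun h => hPQ (pell_ne_zero hA hB h)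
  have key : X ^ (4 * n) * D = Z * (2 * (X ^ (2 * n) * P) - Z) + Q ^ 2 * W := by
    rw [hZ, hD, hWdef, show 4 * n = 2 * n + 2 * n by ring, show 2 * (2 * n) = 2 * n + 2 * n by ring,
      pow_add]; ring
  have bound : ∀ m, m ≤ n → n ≤ m + 2 → P.natDegree ≤ m → 4 * n + D.natDegree ≤ 3 * n + m + 1 := by
    intro m hmn hnm hPm
    have h1 : (X ^ (4 * n) * D).natDegree = 4 * n + D.natDegree := by
      rw [natDegree_mul (by simp) hDne, natDegree_X_pow]
    rw [← h1, key]
    refine natDegree_add_le_of_degree_le ?_ ?_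
    · refine natDegree_mul_le.trans ?_
      have : (2 * (X ^ (2 * n) * P) - Z).natDegree ≤ 2 * n + m := by
        refine natDegree_sub_le'' ?_ (by omega)
        rw [show (2:ℝ[X]) = C 2 from rfl]
        refine (natDegree_C_mul_le _ _).trans (natDegree_mul_le.trans ?_)
        rw [natDegree_X_pow]; omega
      omega
    · refine natDegree_mul_le.trans ?_
      have : (Q ^ 2).natDegree ≤ 2 * (n - 2) := natDegree_pow_le.trans (by omega)
      omega
  have hD1 := bound n le_rfl (by omega) hPn
  obtain ⟨a, b, hab⟩ := exists_eq_X_add_C_of_natDegree_le_one (p := D) (by omega)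
  refine ⟨P, Q, a, b, hab, ?_, hPn, ?_⟩
  · rintro ⟨rfl, rfl⟩; apply hDne; rw [hab]; simp
  · by_contra hcon
    push Not at hcon
    have hP1 : P.natDegree ≤ n - 1 := natDegree_le_pred hPn hcon.1
    have hD2 := bound (n-1) (by omega) (by omega) hP1
    have ha : a = 0 := by
      have : D.natDegree = 0 := by omega
      have h2 := coeff_eq_zero_of_natDegree_lt (p := D) (n := 1) (by omega)
      rw [hab] at h2; simpa using h2
    have hP2 : P.natDegree ≤ n - 2 := natDegree_le_pred hP1 (by
      by_contra h; exact hcon.2 h ha)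
    have := bound (n-2) (by omega) (by omega) hP2
    omega

end Fuchs

namespace Fuchs
open Polynomial

lemma pell_norm {A B : ℝ} (hA : 1 < A) (hB : 1 < B) (n : ℕ) (hn : 3 ≤ n) :
    ∃ (P Q : ℝ[X]) (α : ℝ) (m : ℕ), n ≤ m + 1 ∧ m ≤ n ∧ P.natDegree = m ∧ Q.natDegree + 2 = m ∧
      Q.leadingCoeff = P.leadingCoeff ∧ P ^ 2 - Rp A B * Q ^ 2 = C α * X + C 1 ∧
      0 ≤ 1 + α * B ∧ 0 ≤ 1 - α * A := by
  obtain ⟨P, Q, a, b, hab, hne, hPn, hc⟩ := pell_exists hA hB n (by omega)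
  have e1 : 0 ≤ b + a * B := by
    have := congrArg (eval B) hab
    simp [Rp_eval] at this
    nlinarith [sq_nonneg (P.eval B)]
  have e2 : 0 ≤ b - a * A := by
    have := congrArg (eval (-A)) hab
    simp [Rp_eval] at this
    nlinarith [sq_nonneg (P.eval (-A))]
  have hb : 0 < b := by
    have h0 : 0 ≤ b := by nlinarith
    rcases h0.lt_or_eq with h | h
    · exact h
    · exfalso; apply hne
      subst h
      refine ⟨?_, rfl⟩
      nlinarith
  obtain ⟨m, hm1, hm2, hPm⟩ : ∃ m, n ≤ m + 1 ∧ m ≤ n ∧ P.natDegree = m := by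
    refine ⟨P.natDegree, ?_, hPn, rfl⟩
    rcases hc with h | h
    · have := le_natDegree_of_ne_zero h; omega
    · have := le_natDegree_of_ne_zero h.1; omega
  have hP0 : P ≠ 0 := by rintro rfl; simp at hPm; omega
  have hRQ : Rp A B * Q ^ 2 = P ^ 2 - (C a * X + C b) := by rw [← hab]; ring
  have hdl : (C a * X + C b).degree < (P ^ 2).degree := by
    refine lt_of_le_of_lt degree_linear_le ?_
    rw [degree_pow, degree_eq_natDegree hP0, hPm]
    have h2m : (2 • (m : WithBot ℕ)) = ((2 * m : ℕ) : WithBot ℕ) := by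
      rw [two_nsmul]; norm_cast; omega
    rw [h2m]
    have : 1 < 2 * m := by omega
    exact_mod_cast this
  have hQ0 : Q ≠ 0 := by
    rintro rfl
    have h1 : P ^ 2 = C a * X + C b := by
      apply sub_eq_zero.1; rw [← hRQ]; simp
    rw [h1] at hdl; exact lt_irrefl _ hdl
  have hdeg : Q.natDegree + 2 = m := by
    have h1 : (Rp A B * Q ^ 2).natDegree = 4 + 2 * Q.natDegree := by
      rw [natDegree_mul (Rp_monic A B).ne_zero (pow_ne_zero _ hQ0), Rp_natDegree, natDegree_pow]
    rw [hRQ, natDegree_eq_of_degree_eq (degree_sub_eq_left_of_degree_lt hdl), natDegree_pow, hPm] at h1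
    omega
  have hlc : Q.leadingCoeff ^ 2 = P.leadingCoeff ^ 2 := by
    have h1 : (Rp A B * Q ^ 2).leadingCoeff = Q.leadingCoeff ^ 2 := by
      rw [leadingCoeff_mul, (Rp_monic A B).leadingCoeff, one_mul, leadingCoeff_pow]
    rw [hRQ, leadingCoeff_sub_of_degree_lt hdl, leadingCoeff_pow] at h1
    exact h1.symm
  obtain ⟨Q', hQ'2, hQ'd, hQ'l⟩ : ∃ Q' : ℝ[X], Q' ^ 2 = Q ^ 2 ∧ Q'.natDegree + 2 = m ∧
      Q'.leadingCoeff = P.leadingCoeff := by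
    rcases sq_eq_sq_iff_eq_or_eq_neg.1 hlc with h | h
    · exact ⟨Q, rfl, hdeg, h⟩
    · exact ⟨-Q, by ring, by rwa [natDegree_neg], by rw [leadingCoeff_neg, h, neg_neg]⟩
  set s := 1 / √b with hs
  have hs0 : s ≠ 0 := by positivity
  have hs2 : s ^ 2 * b = 1 := by
    rw [hs, div_pow, Real.sq_sqrt hb.le]; field_simp
  refine ⟨C s * P, C s * Q', s ^ 2 * a, m, hm1, hm2, ?_, ?_, ?_, ?_, ?_, ?_⟩
  · rw [natDegree_C_mul hs0, hPm]
  · rw [natDegree_C_mul hs0, hQ'd]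
  · simp [leadingCoeff_mul, hQ'l]
  · have : (C s * P) ^ 2 - Rp A B * (C s * Q') ^ 2 = C (s ^ 2) * (P ^ 2 - Rp A B * Q ^ 2) := by
      rw [← hQ'2, C_pow]; ring
    rw [this, hab, mul_add, ← C_mul, hs2, C_mul]; ring
  · have := mul_nonneg (sq_nonneg s) e1
    nlinarith
  · have := mul_nonneg (sq_nonneg s) e2
    nlinarith

/-- The Wronskian-type polynomial -/
noncomputable def Np (R P Q : ℝ[X]) : ℝ[X] :=
  (derivative Q * R + C (1/2) * Q * derivative R) * P - derivative P * Q * R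

lemma Np_mul {R P Q : ℝ[X]} {α : ℝ} (h : P ^ 2 - R * Q ^ 2 = C α * X + C 1) :
    Q * Np R P Q = derivative P * (C α * X + C 1) - C (α / 2) * P := by
  have hd := congrArg derivative h
  simp only [derivative_sub, derivative_pow, derivative_mul, derivative_add, derivative_C,
    derivative_X] at hd
  norm_num at hd
  simp only [show (C (2:ℝ)) = 2 from rfl] at hd
  have hα : C α = C (α/2) * 2 := by
    rw [show (2:ℝ[X]) = C 2 from rfl, ← C_mul]; congr 1; ring
  have h12 : C (1/2 : ℝ) * 2 = 1 := by
    rw [show (2:ℝ[X]) = C 2 from rfl, ← C_mul]; norm_num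
  rw [← h, Np]
  have h2 : C (α/2) = P * derivative P - C (1/2) * (derivative R * Q^2) - R * Q * derivative Q := by
    have : C (α / 2) = C (1/2) * C α := by rw [← C_mul]; congr 1; ring
    rw [this, ← hd]
    linear_combination (P * derivative P - R * Q * derivative Q) * h12
  rw [h2]
  ring

lemma d1_bound {A B α d : ℝ} (hA : 1 < A) (hB : 1 < B) (h1 : 0 ≤ 1 + α * B) (h2 : 0 ≤ 1 - α * A)
    (E4 : (d + 1/2) ^ 2 = (1 - A * α) * (1 - α ^ 2) * (1 + B * α) / 4) :
    |d| ≤ 1 + (1 + A) * (1 + B) := by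
  have b1 : α ≤ 1 := by by_contra! h; nlinarith
  have b2 : -1 ≤ α := by by_contra! h; nlinarith
  have b3 : (1 - A * α) ≤ 1 + A := by nlinarith
  have b4 : (1 + B * α) ≤ 1 + B := by nlinarith
  have b5 : (d + 1/2) ^ 2 ≤ (1 + A) * (1 + B) / 4 := by
    rw [E4]
    have g1 : (1 - A * α) * (1 + B * α) ≤ (1 + A) * (1 + B) := by
      apply mul_le_mul b3 b4 <;> linarith
    have g2 : 0 ≤ (1 - A * α) * (1 + B * α) := by
      apply mul_nonneg <;> linarith
    linarith [mul_nonneg g2 (sq_nonneg α)]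
  have b6 : 4 ≤ (1 + A) * (1 + B) := by nlinarith
  generalize (1 + A) * (1 + B) = s at b5 b6
  rw [abs_le]
  constructor <;> nlinarith

lemma Np_eval {A B : ℝ} (hA : 1 < A) (hB : 1 < B) {P Q : ℝ[X]} {α : ℝ} {m : ℕ} (hm : 2 ≤ m)
    (hPm : P.natDegree = m) (hQm : Q.natDegree + 2 = m) (hl : Q.leadingCoeff = P.leadingCoeff)
    (h : P ^ 2 - Rp A B * Q ^ 2 = C α * X + C 1) (h1 : 0 ≤ 1 + α * B) (h2 : 0 ≤ 1 - α * A) :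
    ∃ n0 d1 : ℝ, |d1| ≤ 1 + (1 + A) * (1 + B) ∧ ∀ x, (Np (Rp A B) P Q).eval x =
      (m * x + n0) * (1 + α * x) + d1 * x - α / 2 * x ^ 2 := by
  set N := Np (Rp A B) P Q with hN
  have hQN : Q * N = derivative P * (C α * X + C 1) - C (α / 2) * P := Np_mul h
  have hP0 : P ≠ 0 := by rintro rfl; simp at hPm; omega
  have hlP : P.leadingCoeff ≠ 0 := by simpa using hP0
  have hQ0 : Q ≠ 0 := by
    rintro rfl; apply hlP; rw [← hl]; simp
  have hdP : (derivative P).natDegree ≤ m - 1 := (natDegree_derivative_le P).trans (by omega)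
  have hNd : N.natDegree ≤ 2 := by
    by_cases hN0 : N = 0
    · simp [hN0]
    · have : (Q * N).natDegree ≤ m := by
        rw [hQN]
        refine natDegree_sub_le'' ?_ ?_
        · refine natDegree_mul_le.trans ?_
          have := natDegree_linear_le (a := α) (b := 1)
          omega
        · exact (natDegree_C_mul_le _ _).trans hPm.le
      rw [natDegree_mul hQ0 hN0] at this
      omega
  have hN3 : N = C (N.coeff 2) * X ^ 2 + C (N.coeff 1) * X + C (N.coeff 0) :=
    eq_quadratic_of_degree_le_two (natDegree_le_iff_degree_le.1 hNd)
  have hPc : P.coeff m = P.leadingCoeff := by rw [leadingCoeff, hPm]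
  have hQc : Q.coeff (m - 2) = P.leadingCoeff := by
    rw [← hl, leadingCoeff]; congr 1; omega
  have hdc : (derivative P).coeff (m - 1) = m * P.leadingCoeff := by
    rw [coeff_derivative, show m - 1 + 1 = m by omega, hPc]
    have : ((m - 1 : ℕ) : ℝ) + 1 = m := by
      have : m - 1 + 1 = m := by omega
      exact_mod_cast this
    rw [this, mul_comm]
  have hc2 : N.coeff 2 = (m - 1/2) * α := by
    have e1 : (Q * N).coeff (m - 2 + 2) = Q.coeff (m-2) * N.coeff 2 :=
      coeff_mul_add_eq_of_natDegree_le (by omega) hNd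
    have e2 : (derivative P * (C α * X + C 1)).coeff (m - 1 + 1) =
        (derivative P).coeff (m-1) * (C α * X + C 1).coeff 1 :=
      coeff_mul_add_eq_of_natDegree_le hdP natDegree_linear_le
    rw [show m - 2 + 2 = m by omega] at e1
    rw [show m - 1 + 1 = m by omega] at e2
    have e3 : (C α * X + C 1 : ℝ[X]).coeff 1 = α := by
      rw [coeff_add, coeff_C_mul, coeff_X_one, coeff_C]; simp
    rw [hQN, coeff_sub, e2, hdc, coeff_C_mul, hPc, hQc, e3] at e1
    have : P.leadingCoeff * (N.coeff 2 - (m - 1/2) * α) = 0 := by linarith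
    have := (mul_eq_zero.1 this).resolve_left hlP
    linarith
  refine ⟨N.coeff 0, N.coeff 1 - m - N.coeff 0 * α, ?_, ?_⟩
  · by_cases hα : α = 0
    · subst hα
      have hN1 : N.natDegree ≤ 1 := natDegree_le_pred hNd (by simp [hc2])
      have e1 : (Q * N).coeff (m - 2 + 1) = Q.coeff (m-2) * N.coeff 1 :=
        coeff_mul_add_eq_of_natDegree_le (by omega) hN1
      rw [show m - 2 + 1 = m - 1 by omega, hQN] at e1
      simp at e1
      rw [hdc, hQc] at e1
      have : P.leadingCoeff * (N.coeff 1 - m) = 0 := by linarith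
      have := (mul_eq_zero.1 this).resolve_left hlP
      have h0 : N.coeff 1 - m - N.coeff 0 * 0 = 0 := by linarith
      rw [h0, abs_zero]; nlinarith
    · set d := N.coeff 1 - m - N.coeff 0 * α with hd
      set l := -1/α with hl'
      have hla : α * l = -1 := by rw [hl']; field_simp
      have E0 := congrArg (eval l) h
      simp at E0
      have E0 : P.eval l ^ 2 = (Rp A B).eval l * Q.eval l ^ 2 := by linarith
      have E1 := congrArg (eval l) hQN
      simp at E1
      have E1 : Q.eval l * N.eval l = - (α / 2 * P.eval l) := by
        rw [E1, hla]; ring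
      have hQl : Q.eval l ≠ 0 := by
        intro h0
        have hP0 : P.eval l = 0 := by simpa [h0] using E0
        have hd := congrArg (fun p => eval l (derivative p)) h
        simp [derivative_pow, h0, hP0] at hd
        exact hα hd.symm
      have E2 : N.eval l ^ 2 = α ^ 2 / 4 * (Rp A B).eval l := by
        have : Q.eval l ^ 2 * (N.eval l ^ 2 - α ^ 2 / 4 * (Rp A B).eval l) = 0 := by
          have : (Q.eval l * N.eval l) ^ 2 = (α / 2 * P.eval l) ^ 2 := by rw [E1]; ring
          rw [mul_pow, mul_pow, E0] at this
          linarith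
        have := (mul_eq_zero.1 this).resolve_left (pow_ne_zero _ hQl)
        linarith
      have E3 : α * N.eval l = - (d + 1/2) := by
        rw [hN3]; simp only [eval_add, eval_mul, eval_C, eval_X, eval_pow]
        rw [hc2, hd]
        have : l = -1/α := rfl
        rw [this]
        field_simp
        ring
      have E4 : (d + 1/2) ^ 2 = (1 - A * α) * (1 - α ^ 2) * (1 + B * α) / 4 := by
        have : (α * N.eval l) ^ 2 = (d + 1/2) ^ 2 := by rw [E3]; ring
        rw [← this, mul_pow, E2, Rp_eval]
        have : l = -1/α := rfl
        rw [this]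
        field_simp
        ring
      exact d1_bound hA hB h1 h2 E4
  · intro x
    conv_lhs => rw [hN3]
    simp only [eval_add, eval_mul, eval_C, eval_X, eval_pow]
    rw [hc2]; ring

end Fuchs

namespace Fuchs
open Polynomial

/-- Solutions of the Pell type equation. -/
structure Pell (A B : ℝ) (P Q : ℝ[X]) (α : ℝ) (m : ℕ) : Prop where
  hm : 2 ≤ m
  hP : P.natDegree = m
  hQ : Q.natDegree + 2 = m
  hl : Q.leadingCoeff = P.leadingCoeff
  eq : P ^ 2 - Rp A B * Q ^ 2 = C α * X + C 1
  h1 : 0 ≤ 1 + α * B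
  h2 : 0 ≤ 1 - α * A

lemma Pell.exists {A B : ℝ} (hA : 1 < A) (hB : 1 < B) (n : ℕ) (hn : 3 ≤ n) :
    ∃ (P Q : ℝ[X]) (α : ℝ) (m : ℕ), n ≤ m + 1 ∧ m ≤ n ∧ Pell A B P Q α m := by
  obtain ⟨P, Q, α, m, h1, h2, h3, h4, h5, h6, h7, h8⟩ := pell_norm hA hB n hn
  exact ⟨P, Q, α, m, h1, h2, by omega, h3, h4, h5, h6, h7, h8⟩

lemma Pell.eval_eq {A B : ℝ} {P Q : ℝ[X]} {α : ℝ} {m : ℕ} (h : Pell A B P Q α m) (x : ℝ) :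
    P.eval x ^ 2 - (Rp A B).eval x * Q.eval x ^ 2 = 1 + α * x := by
  have := congrArg (eval x) h.eq
  simp at this
  linarith

lemma wt_eq (A B x : ℝ) : wt A B x = 1 / √((Rp A B).eval x) := by
  rw [wt, Rp_eval]; congr 2; ring

lemma wt_nonneg (A B x : ℝ) : 0 ≤ wt A B x := by unfold wt; positivity

lemma Rp_pos {A B x : ℝ} (hA : 1 < A) (hB : 1 < B) (hx : x ∈ Ioo (-1:ℝ) 1) :
    0 < (Rp A B).eval x := by
  rw [Rp_eval, show (x + A) * (x ^ 2 - 1) * (x - B) = (x + A) * ((1 - x) * (1 + x)) * (B - x) by ring]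
  have := hx.1; have := hx.2
  apply mul_pos (mul_pos _ (mul_pos _ _)) <;> linarith

lemma wt_pos {A B x : ℝ} (hA : 1 < A) (hB : 1 < B) (hx : x ∈ Ioo (-1:ℝ) 1) : 0 < wt A B x := by
  rw [wt_eq]; have := Rp_pos hA hB hx; positivity

lemma wt_int {A B : ℝ} (hA : 1 < A) (hB : 1 < B) : IntervalIntegrable (wt A B) volume (-1) 1 := by
  have h := Polynomial.Chebyshev.intervalIntegrable_sqrt_one_sub_sq_inv.mul_continuousOn
    (g := fun x => (√((x + A) * (B - x)))⁻¹) (by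
      rw [uIcc_of_le (by norm_num)]
      apply ContinuousOn.inv₀
      · fun_prop
      · intro x hx
        have : 0 < (x + A) * (B - x) := mul_pos (by linarith [hx.1]) (by linarith [hx.2])
        positivity)
  refine h.congr_ae ?_
  refine (ae_restrict_iff' measurableSet_uIoc).2 (Eventually.of_forall ?_)
  intro x hx
  rw [uIoc_of_le (by norm_num)] at hx
  have h1 : 0 ≤ 1 - x ^ 2 := by nlinarith [hx.1, hx.2]
  simp only [wt]
  rw [mul_assoc, Real.sqrt_mul h1, one_div, mul_inv, Real.sqrt_inv]

lemma mul_wt_int {A B : ℝ} (hA : 1 < A) (hB : 1 < B) {f : ℝ → ℝ} (hf : ContinuousOn f (Icc (-1) 1))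
    {a b : ℝ} (ha : a ∈ Icc (-1:ℝ) 1) (hb : b ∈ Icc (-1:ℝ) 1) :
    IntervalIntegrable (fun x => f x * wt A B x) volume a b := by
  have := (wt_int hA hB).continuousOn_mul (g := f) (by rwa [uIcc_of_le (by norm_num)])
  refine this.mono_set ?_
  rw [uIcc_of_le (by norm_num : (-1:ℝ) ≤ 1)]
  exact uIcc_subset_Icc ha hb

noncomputable def Wm (A B : ℝ) : ℝ := ∫ x in (-1:ℝ)..1, wt A B x

lemma Wm_pos {A B : ℝ} (hA : 1 < A) (hB : 1 < B) : 0 < Wm A B :=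
  intervalIntegral.intervalIntegral_pos_of_pos_on (wt_int hA hB) (fun _ hx => wt_pos hA hB hx)
    (by norm_num)

lemma Ccrit_mem {A B : ℝ} (hA : 1 < A) (hB : 1 < B) : Ccrit A B ∈ Ioo (-1:ℝ) 1 := by
  have hW := Wm_pos hA hB
  have l1 : (-1:ℝ) ∈ Icc (-1:ℝ) 1 := by norm_num
  have l2 : (1:ℝ) ∈ Icc (-1:ℝ) 1 := by norm_num
  have i1 := mul_wt_int hA hB (f := fun x => x) (by fun_prop) l1 l2
  have p1 : 0 < ∫ x in (-1:ℝ)..1, (1 - x) * wt A B x :=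
    intervalIntegral.intervalIntegral_pos_of_pos_on (mul_wt_int hA hB (by fun_prop) l1 l2)
     (fun x hx => mul_pos (by linarith [hx.2]) (wt_pos hA hB hx)) (by norm_num)
  have p2 : 0 < ∫ x in (-1:ℝ)..1, (x + 1) * wt A B x :=
    intervalIntegral.intervalIntegral_pos_of_pos_on (mul_wt_int hA hB (by fun_prop) l1 l2)
     (fun x hx => mul_pos (by linarith [hx.1]) (wt_pos hA hB hx)) (by norm_num)
  simp only [sub_mul, add_mul, one_mul] at p1 p2
  rw [intervalIntegral.integral_sub (wt_int hA hB) i1] at p1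
  rw [intervalIntegral.integral_add i1 (wt_int hA hB)] at p2
  unfold Ccrit
  constructor
  · rw [lt_div_iff₀ (by exact hW)]; linarith
  · rw [div_lt_iff₀ (by exact hW)]; linarith

noncomputable def Gg (A B x : ℝ) : ℝ := ∫ t in (-1:ℝ)..x, (Ccrit A B - t) * wt A B t

lemma Gg_C (A B : ℝ) : Gg A B (Ccrit A B) = eta A B := rfl

lemma wt_ge {A B x : ℝ} (hA : 1 < A) (hB : 1 < B) (hx : x ∈ Ioo (-1:ℝ) 1) :
    1 / √((1 + A) * (1 + B)) ≤ wt A B x := by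
  unfold wt
  have h1 : 0 < 1 - x ^ 2 := by nlinarith [hx.1, hx.2]
  have h2 : 0 < x + A := by linarith [hx.1]
  have h3 : 0 < B - x := by linarith [hx.2]
  apply one_div_le_one_div_of_le (by positivity)
  apply Real.sqrt_le_sqrt
  apply mul_le_mul _ _ h3.le (by positivity)
  · nlinarith [hx.2, sq_nonneg x]
  · linarith [hx.1]

lemma Gg_le {A B : ℝ} (hA : 1 < A) (hB : 1 < B) : ∃ c > 0, ∀ x ∈ Icc (-1:ℝ) 1,
    Gg A B x ≤ eta A B - c * (x - Ccrit A B) ^ 2 := by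
  set w0 := 1 / √((1 + A) * (1 + B)) with hw0
  have hw : 0 < w0 := by positivity
  refine ⟨w0 / 2, by positivity, fun x hx => ?_⟩
  have hC := Ccrit_mem hA hB
  set c := Ccrit A B with hc
  have hC' : c ∈ Icc (-1:ℝ) 1 := Ioo_subset_Icc_self hC
  have l1 : (-1:ℝ) ∈ Icc (-1:ℝ) 1 := by norm_num
  have hf : ContinuousOn (fun t : ℝ => c - t) (Icc (-1) 1) := by fun_prop
  have hadd : Gg A B x + ∫ t in x..c, (c - t) * wt A B t = eta A B :=
    intervalIntegral.integral_add_adjacent_intervals (mul_wt_int hA hB hf l1 hx)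
      (mul_wt_int hA hB hf hx hC')
  have hIntegr : ∀ a b : ℝ, ∫ t in a..b, (c - t) * w0 = w0 / 2 * ((c - a) ^ 2 - (c - b) ^ 2) := by
    intro a b
    rw [intervalIntegral.integral_mul_const, intervalIntegral.integral_sub (by simp) (by simp)]
    simp; ring
  have key : w0 / 2 * (x - c) ^ 2 ≤ ∫ t in x..c, (c - t) * wt A B t := by
    rcases le_total x c with h | h
    · have := intervalIntegral.integral_mono_on_of_le_Ioo h (f := fun t => (c - t) * w0)
        (g := fun t => (c - t) * wt A B t) (Continuous.intervalIntegrable (by fun_prop) _ _)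
        (mul_wt_int hA hB hf hx hC') (fun t ht => by
          apply mul_le_mul_of_nonneg_left _ (by linarith [ht.2])
          exact wt_ge hA hB ⟨by linarith [hx.1, ht.1], by linarith [hC.2, ht.2]⟩)
      rw [hIntegr] at this
      linarith
    · have := intervalIntegral.integral_mono_on_of_le_Ioo h (g := fun t => (c - t) * w0)
        (f := fun t => (c - t) * wt A B t)
        (mul_wt_int hA hB hf hC' hx) (Continuous.intervalIntegrable (by fun_prop) _ _) (fun t ht => by
          apply mul_le_mul_of_nonpos_left _ (by linarith [ht.1])
          exact wt_ge hA hB ⟨by linarith [hC.1, ht.1], by linarith [hx.2, ht.2]⟩)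
      rw [hIntegr] at this
      rw [intervalIntegral.integral_symm]
      linarith
  linarith

noncomputable def kap (A B : ℝ) : ℝ := min (1 - 1 / A) (1 - 1 / B)

lemma kap_pos {A B : ℝ} (hA : 1 < A) (hB : 1 < B) : 0 < kap A B := by
  unfold kap
  apply lt_min <;>
  · rw [sub_pos, div_lt_one] <;> linarith

lemma ell_ge {A B α x : ℝ} (hA : 1 < A) (hB : 1 < B) (h1 : 0 ≤ 1 + α * B) (h2 : 0 ≤ 1 - α * A)
    (hx : x ∈ Icc (-1:ℝ) 1) : kap A B ≤ 1 + α * x ∧ 1 + α * x ≤ 2 ∧ |α| ≤ 1 := by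
  have a1 : α ≤ 1 / A := by rw [le_div_iff₀ (by linarith)]; linarith
  have a2 : -(1 / B) ≤ α := by
    rw [← neg_div, div_le_iff₀ (by linarith)]; linarith
  have a3 : 1 / A < 1 := by rw [div_lt_one] <;> linarith
  have a4 : 1 / B < 1 := by rw [div_lt_one] <;> linarith
  have a5 : kap A B ≤ 1 - 1 / A := min_le_left _ _
  have a6 : kap A B ≤ 1 - 1 / B := min_le_right _ _
  refine ⟨?_, ?_, abs_le.2 ⟨by linarith, by linarith⟩⟩
  · rcases le_total 0 α with h | h
    · nlinarith [hx.1, hx.2]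
    · nlinarith [hx.1, hx.2]
  · have := hx.1; have := hx.2
    rcases le_total 0 α with h | h <;> nlinarith

noncomputable def FF (A B : ℝ) (P Q : ℝ[X]) (x : ℝ) : ℝ := P.eval x + Q.eval x * √((Rp A B).eval x)

lemma FF_mul {A B : ℝ} (hA : 1 < A) (hB : 1 < B) {P Q : ℝ[X]} {α : ℝ} {m : ℕ}
    (h : Pell A B P Q α m) {x : ℝ} (hx : x ∈ Icc (-1:ℝ) 1) :
    FF A B P Q x * (P.eval x - Q.eval x * √((Rp A B).eval x)) = 1 + α * x := by
  have hR : 0 ≤ (Rp A B).eval x := by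
    rw [Rp_eval, show (x + A) * (x ^ 2 - 1) * (x - B) = (x + A) * ((1 - x) * (1 + x)) * (B - x) by ring]
    have := hx.1; have := hx.2
    apply mul_nonneg (mul_nonneg _ (mul_nonneg _ _)) <;> linarith
  rw [← h.eval_eq, FF]
  have := Real.sq_sqrt hR
  linear_combination (- Q.eval x ^2) * this

lemma FF_ne {A B : ℝ} (hA : 1 < A) (hB : 1 < B) {P Q : ℝ[X]} {α : ℝ} {m : ℕ}
    (h : Pell A B P Q α m) {x : ℝ} (hx : x ∈ Icc (-1:ℝ) 1) : FF A B P Q x ≠ 0 := by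
  intro h0
  have := FF_mul hA hB h hx
  rw [h0, zero_mul] at this
  have := (ell_ge hA hB h.h1 h.h2 hx).1
  have := kap_pos hA hB
  linarith

lemma FF_deriv {A B : ℝ} (hA : 1 < A) (hB : 1 < B) {P Q : ℝ[X]} {α : ℝ} {m : ℕ}
    (h : Pell A B P Q α m) {x : ℝ} (hx : x ∈ Ioo (-1:ℝ) 1) :
    HasDerivAt (fun x => Real.log (FF A B P Q x) - Real.log (1 + α * x) / 2)
      ((Np (Rp A B) P Q).eval x / (1 + α * x) * wt A B x) x := by
  have hx' := Ioo_subset_Icc_self hx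
  have hF := FF_ne hA hB h hx'
  have hell : 0 < 1 + α * x := (kap_pos hA hB).trans_le (ell_ge hA hB h.h1 h.h2 hx').1
  have hR := Rp_pos hA hB hx
  have d1 : HasDerivAt (FF A B P Q) (P.derivative.eval x + (Q.derivative.eval x * √((Rp A B).eval x) +
      Q.eval x * ((Rp A B).derivative.eval x / (2 * √((Rp A B).eval x))))) x :=
    (P.hasDerivAt x).add ((Q.hasDerivAt x).mul (((Rp A B).hasDerivAt x).sqrt hR.ne'))
  have d2 : HasDerivAt (fun x => 1 + α * x) α x := by
    simpa using ((hasDerivAt_id x).const_mul α).const_add 1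
  have d3 := (d1.log hF).sub ((d2.log hell.ne').div_const 2)
  refine d3.congr_deriv ?_
  rw [wt_eq]
  have hs := Real.sq_sqrt hR.le
  have hs0 : 0 < √((Rp A B).eval x) := by positivity
  have e1 := h.eval_eq x
  have e2 := congrArg (fun p => eval x (derivative p)) h.eq
  simp [derivative_pow] at e2
  have e3 : (Np (Rp A B) P Q).eval x = (Q.derivative.eval x * (Rp A B).eval x + 1/2 * Q.eval x *
    (Rp A B).derivative.eval x) * P.eval x - P.derivative.eval x * Q.eval x * (Rp A B).eval x := by
    simp [Np]
  rw [e3]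
  have hF' : P.eval x + Q.eval x * √((Rp A B).eval x) ≠ 0 := hF
  unfold FF
  generalize √((Rp A B).eval x) = s at *
  generalize (Rp A B).eval x = r at *
  subst hs
  generalize (Rp A B).derivative.eval x = r' at *
  generalize P.eval x = p at *
  generalize Q.eval x = q at *
  generalize P.derivative.eval x = p' at *
  generalize Q.derivative.eval x = q' at *
  have hsne := hs0.ne'
  rw [← e1] at hell ⊢
  have hl := hell.ne'
  rw [← e2]
  clear d1 d2 d3 e1 e2 e3 hF
  obtain ⟨L, hL⟩ : ∃ L, L = p + q * s := ⟨_, rfl⟩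
  obtain ⟨M, hM⟩ : ∃ M, M = p ^ 2 - s ^ 2 * q ^ 2 := ⟨_, rfl⟩
  rw [← hL] at hF' ⊢
  rw [← hM] at hl ⊢
  field_simp
  rw [hL, hM]
  ring

lemma KP {A B : ℝ} (hA : 1 < A) (hB : 1 < B) : ∃ K : ℝ, ∀ (P Q : ℝ[X]) (α : ℝ) (m : ℕ),
    Pell A B P Q α m → ∀ x ∈ Icc (-1:ℝ) 1, |Real.log (FF A B P Q x) + m * Gg A B x| ≤ K := by
  set κ := kap A B with hκ
  have hκ0 : 0 < κ := kap_pos hA hB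
  set K0 := ((1 + (1 + A) * (1 + B)) + 1) / κ with hK0
  set W := Wm A B with hW
  have hW0 : 0 < W := Wm_pos hA hB
  refine ⟨2 * K0 * W + (|Real.log κ| + Real.log 2), ?_⟩
  intro P Q α m h x hx
  obtain ⟨n0, d1, hd1, hN⟩ := Np_eval hA hB h.hm h.hP h.hQ h.hl h.eq h.h1 h.h2
  have hell : ∀ t ∈ Icc (-1:ℝ) 1, κ ≤ 1 + α * t := fun t ht => (ell_ge hA hB h.h1 h.h2 ht).1
  have hα : |α| ≤ 1 := (ell_ge hA hB h.h1 h.h2 hx).2.2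
  set e : ℝ → ℝ := fun t => (d1 * t - α / 2 * t ^ 2) / (1 + α * t) with he
  have hec : ContinuousOn e (Icc (-1) 1) := by
    apply ContinuousOn.div (by fun_prop) (by fun_prop)
    intro t ht; have := hell t ht; linarith
  have heb : ∀ t ∈ Icc (-1:ℝ) 1, |e t| ≤ K0 := by
    intro t ht
    have h1 := hell t ht
    rw [he]; simp only
    rw [abs_div, abs_of_pos (by linarith : 0 < 1 + α * t), hK0]
    have ht1 : |t| ≤ 1 := abs_le.2 ht
    have h2 : |d1 * t - α / 2 * t ^ 2| ≤ (1 + (1 + A) * (1 + B)) + 1 := by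
      refine (abs_sub _ _).trans ?_
      rw [abs_mul, abs_mul, abs_div, abs_pow]
      have q1 : |d1| * |t| ≤ (1 + (1 + A) * (1 + B)) * 1 := mul_le_mul hd1 ht1 (abs_nonneg _) (by nlinarith)
      have q2 : |α| / |2| * |t| ^ 2 ≤ 1 * 1 := by
        apply mul_le_mul _ _ (by positivity) (by norm_num)
        · rw [abs_of_pos (by norm_num : (0:ℝ) < 2)]; linarith
        · exact pow_le_one₀ (abs_nonneg _) ht1
      linarith
    exact div_le_div₀ (by nlinarith) h2 hκ0 h1
  set Φ : ℝ → ℝ := fun x => Real.log (FF A B P Q x) - Real.log (1 + α * x) / 2 with hΦ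
  have hΦc : ContinuousOn Φ (Icc (-1) 1) := by
    apply ContinuousOn.sub
    · apply ContinuousOn.log
      · unfold FF; fun_prop
      · intro t ht; exact FF_ne hA hB h ht
    · apply ContinuousOn.div_const
      apply ContinuousOn.log (by fun_prop)
      intro t ht; have := hell t ht; linarith
  have hΦe : ∀ t : ℝ, (Rp A B).eval t = 0 → Φ t = 0 := by
    intro t ht
    have := h.eval_eq t
    simp only [hΦ, FF]
    rw [← this, ht]; simp
  have hm1 : Φ (-1) = 0 := hΦe _ (by rw [Rp_eval]; norm_num)
  have hp1 : Φ 1 = 0 := hΦe _ (by rw [Rp_eval]; norm_num)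
  have l1 : (-1:ℝ) ∈ Icc (-1:ℝ) 1 := by norm_num
  have l2 : (1:ℝ) ∈ Icc (-1:ℝ) 1 := by norm_num
  have hFTC : ∀ y ∈ Icc (-1:ℝ) 1, ∫ t in (-1:ℝ)..y, (m * t + n0 + e t) * wt A B t = Φ y := by
    intro y hy
    rw [intervalIntegral.integral_eq_sub_of_hasDerivAt_of_le hy.1 (f := Φ)
      (hΦc.mono (Icc_subset_Icc_right hy.2)), hm1, sub_zero]
    · intro t ht
      have ht' : t ∈ Ioo (-1:ℝ) 1 := ⟨ht.1, ht.2.trans_le hy.2⟩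
      refine (FF_deriv hA hB h ht').congr_deriv ?_
      congr 1
      rw [hN, he]
      have := hell t (Ioo_subset_Icc_self ht')
      have : 1 + α * t ≠ 0 := by linarith
      simp only
      obtain ⟨L, hL⟩ : ∃ L, L = 1 + α * t := ⟨_, rfl⟩
      rw [← hL] at this ⊢
      field_simp
      ring
    · exact mul_wt_int hA hB (by fun_prop) l1 hy
  have hbd : ∀ f : ℝ → ℝ, ContinuousOn f (Icc (-1) 1) → ∀ k, (∀ t ∈ Icc (-1:ℝ) 1, |f t| ≤ k) →
      ∀ y ∈ Icc (-1:ℝ) 1, |∫ t in (-1:ℝ)..y, f t * wt A B t| ≤ k * W := by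
    intro f hf k hk y hy
    have hk0 : 0 ≤ k := (abs_nonneg _).trans (hk 0 (by norm_num))
    have g1 : ‖∫ t in (-1:ℝ)..y, f t * wt A B t‖ ≤ ∫ t in (-1:ℝ)..y, k * wt A B t := by
      apply intervalIntegral.norm_integral_le_of_norm_le hy.1
      · refine Eventually.of_forall fun t ht => ?_
        rw [norm_mul, Real.norm_eq_abs, Real.norm_eq_abs, abs_of_nonneg (wt_nonneg A B t)]
        exact mul_le_mul_of_nonneg_right (hk t ⟨ht.1.le, ht.2.trans hy.2⟩) (wt_nonneg A B t)
      · exact mul_wt_int hA hB (f := fun _ => k) (by fun_prop) l1 hy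
    have g2 : ∫ t in (-1:ℝ)..y, k * wt A B t ≤ ∫ t in (-1:ℝ)..1, k * wt A B t := by
      apply intervalIntegral.integral_mono_interval le_rfl hy.1 hy.2
      · exact Eventually.of_forall fun t => mul_nonneg hk0 (wt_nonneg A B t)
      · exact mul_wt_int hA hB (f := fun _ => k) (by fun_prop) l1 l2
    rw [intervalIntegral.integral_const_mul k _ (a := -1) (b := 1)] at g2
    exact (Real.norm_eq_abs _ ▸ g1).trans g2
  set c := Ccrit A B with hc
  have hCW : ∫ t in (-1:ℝ)..1, t * wt A B t = c * W := by
    rw [hc, Ccrit, hW, Wm, div_mul_cancel₀]; exact hW0.ne'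
  have hmc : |m * c + n0| ≤ K0 := by
    have e1 := hFTC 1 l2
    rw [hp1] at e1
    have e2 : ∫ t in (-1:ℝ)..1, (m * t + n0 + e t) * wt A B t =
        m * (c * W) + n0 * W + ∫ t in (-1:ℝ)..1, e t * wt A B t := by
      rw [← hCW, hW, Wm, ← intervalIntegral.integral_const_mul, ← intervalIntegral.integral_const_mul,
        ← intervalIntegral.integral_add, ← intervalIntegral.integral_add]
      · congr 1; ext t; ring
      · apply IntervalIntegrable.add
        · exact (mul_wt_int hA hB (by fun_prop) l1 l2).const_mul _
        · exact mul_wt_int hA hB (f := fun _ => n0) (by fun_prop) l1 l2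
      · exact mul_wt_int hA hB hec l1 l2
      · exact (mul_wt_int hA hB (by fun_prop) l1 l2).const_mul _
      · exact mul_wt_int hA hB (f := fun _ => n0) (by fun_prop) l1 l2
    have e3 := hbd e hec K0 heb 1 l2
    have e4 : (m * c + n0) * W = - ∫ t in (-1:ℝ)..1, e t * wt A B t := by
      rw [e1] at e2; linarith
    have e5 : |m * c + n0| * W ≤ K0 * W := by
      rw [← abs_of_pos hW0, ← abs_mul, abs_of_pos hW0, e4, abs_neg]; exact e3
    exact le_of_mul_le_mul_right e5 hW0
  have hsum : Φ x + m * Gg A B x = ∫ t in (-1:ℝ)..x, (m * c + n0 + e t) * wt A B t := by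
    rw [← hFTC x hx, Gg, ← intervalIntegral.integral_const_mul, ← intervalIntegral.integral_add]
    · congr 1; ext t; ring
    · exact mul_wt_int hA hB (by fun_prop) l1 hx
    · exact (mul_wt_int hA hB (by fun_prop) l1 hx).const_mul _
  have hfin : |Φ x + m * Gg A B x| ≤ 2 * K0 * W := by
    rw [hsum]
    refine hbd _ (by fun_prop) _ (fun t ht => ?_) x hx
    have := abs_add_le (m * c + n0) (e t)
    have := heb t ht
    linarith
  have hlog : |Real.log (1 + α * x) / 2| ≤ |Real.log κ| + Real.log 2 := by
    have h1 := hell x hx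
    have h2 := (ell_ge hA hB h.h1 h.h2 hx).2.1
    have g1 := Real.log_le_log hκ0 h1
    have g2 := Real.log_le_log (by linarith) h2
    have g3 : 0 ≤ Real.log 2 := Real.log_nonneg (by norm_num)
    have g4 := neg_abs_le (Real.log κ)
    have g5 := abs_nonneg (Real.log κ)
    rw [abs_le]; constructor <;> linarith
  have : Real.log (FF A B P Q x) + m * Gg A B x = (Φ x + m * Gg A B x) + Real.log (1 + α * x) / 2 := by
    rw [hΦ]; ring
  rw [this]
  exact (abs_add_le _ _).trans (add_le_add hfin hlog)

end Fuchs

namespace Fuchs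
open Polynomial

lemma multiset_lin (s : Multiset ℂ) (hs : (0:ℂ) ∉ s) : ∃ t : Multiset ℝ, t.card = s.card ∧
    ∀ u : ℝ, ‖(s.map (fun z => (0:ℂ) - z)).prod‖ * |(t.map (fun b => 1 + b * u)).prod| ≤
      ‖(s.map (fun z => (u:ℂ) - z)).prod‖ := by
  induction s using Multiset.induction_on with
  | empty => exact ⟨0, by simp, by simp⟩
  | cons z s ih =>
    simp only [Multiset.mem_cons, not_or] at hs
    obtain ⟨t, ht, h⟩ := ih hs.2
    have hz : z ≠ 0 := Ne.symm hs.1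
    refine ⟨(-(1/z)).re ::ₘ t, by simp [ht], fun u => ?_⟩
    simp only [Multiset.map_cons, Multiset.prod_cons, norm_mul, abs_mul]
    have h1 : ‖(0:ℂ) - z‖ * |1 + (-(1/z)).re * u| ≤ ‖(u:ℂ) - z‖ := by
      have e1 : 1 + (-(1/z)).re * u = (1 - u / z).re := by
        rw [Complex.sub_re, Complex.neg_re, div_eq_mul_one_div (u:ℂ) z, Complex.re_ofReal_mul]
        simp; ring
      have e2 : ‖(u:ℂ) - z‖ = ‖(0:ℂ) - z‖ * ‖1 - u / z‖ := by
        rw [← norm_mul]; congr 1; field_simp; ring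
      rw [e1, e2]
      exact mul_le_mul_of_nonneg_left (Complex.abs_re_le_norm _) (norm_nonneg _)
    calc _ = (‖(0:ℂ) - z‖ * |1 + (-(1/z)).re * u|) *
          (‖(s.map (fun z => (0:ℂ) - z)).prod‖ * |(t.map (fun b => 1 + b * u)).prod|) := by ring
      _ ≤ _ := mul_le_mul h1 (h u) (by positivity) (by positivity)

lemma lin_factors (P : ℝ[X]) (hP : P.eval 0 ≠ 0) : ∃ t : Multiset ℝ, t.card = P.natDegree ∧
    ∀ u : ℝ, |P.eval 0| * |(t.map (fun b => 1 + b * u)).prod| ≤ |P.eval u| := by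
  set Pc := P.map (algebraMap ℝ ℂ) with hPc
  have hev : ∀ u : ℝ, Pc.eval (u:ℂ) = ((P.eval u : ℝ) : ℂ) := by
    intro u; rw [hPc, eval_map_algebraMap]
    exact (Polynomial.aeval_algebraMap_apply_eq_algebraMap_eval (A := ℂ) u P)
  have hsp : Pc.Splits := IsAlgClosed.splits _
  have h0 : (0:ℂ) ∉ Pc.roots := by
    intro h
    have := (mem_roots'.1 h).2
    rw [IsRoot] at this
    have h2 := hev 0
    rw [Complex.ofReal_zero, this] at h2
    exact hP (by exact_mod_cast h2.symm)
  obtain ⟨t, ht, h⟩ := multiset_lin Pc.roots h0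
  refine ⟨t, ?_, fun u => ?_⟩
  · rw [ht, ← hsp.natDegree_eq_card_roots, hPc, natDegree_map]
  · have e1 : |P.eval u| = ‖Pc.leadingCoeff‖ * ‖(Pc.roots.map (fun z => (u:ℂ) - z)).prod‖ := by
      rw [← norm_mul, ← hsp.eval_eq_prod_roots, hev, Complex.norm_real, Real.norm_eq_abs]
    have e0 : |P.eval 0| = ‖Pc.leadingCoeff‖ * ‖(Pc.roots.map (fun z => (0:ℂ) - z)).prod‖ := by
      rw [← norm_mul, ← hsp.eval_eq_prod_roots, ← Complex.ofReal_zero, hev, Complex.norm_real, Real.norm_eq_abs]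
    rw [e1, e0, mul_assoc]
    exact mul_le_mul_of_nonneg_left (h u) (norm_nonneg _)

lemma aeval_I (y b c : ℝ) : ‖aeval (Complex.I * y) (1 + C b * X - C c * X ^ 2 : ℝ[X])‖ ^ 2 =
    (1 + c * y ^ 2) ^ 2 + b ^ 2 * y ^ 2 := by
  have : aeval (Complex.I * y) (1 + C b * X - C c * X ^ 2 : ℝ[X]) =
      ((1 + c * y ^ 2 : ℝ) : ℂ) + ((b * y : ℝ) : ℂ) * Complex.I := by
    simp [aeval_C]
    rw [mul_pow, Complex.I_sq]; ring
  rw [this, ← Complex.normSq_eq_norm_sq, Complex.normSq_add_mul_I]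
  ring

lemma surgery_list {D : ℝ} (hD : 0 < D) (t : Multiset ℝ) :
    ∃ q : ℝ[X], q.eval 0 = 1 ∧ ∃ d : ℕ, q.natDegree ≤ d ∧
    (∀ y : ℝ, (1 + (1 / (4 * D)) ^ 2 * y ^ 2) ^ d ≤ ‖aeval (Complex.I * y) q‖ ^ 2) ∧
    ((t.card = d ∧ ∀ u, |u| ≤ D → |q.eval u| ≤ |(t.map (fun b => 1 + b * u)).prod|) ∨
     (t.card = d + 1 ∧ ∃ c, |c| ≤ 1 / (4 * D) ∧ ∀ u, |u| ≤ D →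
        |q.eval u| * |1 + c * u| ≤ |(t.map (fun b => 1 + b * u)).prod|)) := by
  set a := 1 / (4 * D) with ha
  have ha0 : 0 < a := by positivity
  have haD : a * D = 1 / 4 := by rw [ha]; field_simp
  induction t using Multiset.induction_on with
  | empty => exact ⟨1, by simp, 0, by simp, by simp, Or.inl ⟨by simp, by simp⟩⟩
  | cons b t ih =>
    obtain ⟨q, hq0, d, hqd, hqy, h⟩ := ih
    simp only [Multiset.map_cons, Multiset.prod_cons, Multiset.card_cons, abs_mul]
    by_cases hb : a ≤ |b|
    · refine ⟨(1 + C b * X - C 0 * X ^ 2) * q, by simp [hq0], d + 1, ?_, fun y => ?_, ?_⟩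
      · refine natDegree_mul_le.trans ?_
        have : (1 + C b * X - C 0 * X ^ 2 : ℝ[X]).natDegree ≤ 1 := by
          rw [C_0, zero_mul, sub_zero, add_comm, ← C_1]; exact natDegree_linear_le
        omega
      · rw [map_mul, norm_mul, mul_pow, aeval_I, pow_succ, mul_comm]
        apply mul_le_mul _ (hqy y) (by positivity) (by positivity)
        have : a ^ 2 ≤ b ^ 2 := by rw [← sq_abs b]; exact pow_le_pow_left₀ ha0.le hb 2
        nlinarith [sq_nonneg y]
      · have e : ∀ u, |((1 + C b * X - C 0 * X ^ 2) * q).eval u| = |1 + b * u| * |q.eval u| := by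
          intro u; rw [← abs_mul]; simp
        simp only [e]
        rcases h with ⟨h1, h2⟩ | ⟨h1, c, hc, h2⟩
        · exact Or.inl ⟨by omega, fun u hu => mul_le_mul_of_nonneg_left (h2 u hu) (abs_nonneg _)⟩
        · refine Or.inr ⟨by omega, c, hc, fun u hu => ?_⟩
          rw [mul_assoc]
          exact mul_le_mul_of_nonneg_left (h2 u hu) (abs_nonneg _)
    · push Not at hb
      rcases h with ⟨h1, h2⟩ | ⟨h1, c, hc, h2⟩
      · refine ⟨q, hq0, d, hqd, hqy, Or.inr ⟨by omega, b, hb.le, fun u hu => ?_⟩⟩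
        rw [mul_comm]
        exact mul_le_mul_of_nonneg_left (h2 u hu) (abs_nonneg _)
      · refine ⟨(1 + C (b + c) * X - C (a ^ 2) * X ^ 2) * q, by simp [hq0], d + 2, ?_, fun y => ?_,
          Or.inl ⟨by omega, fun u hu => ?_⟩⟩
        · refine natDegree_mul_le.trans ?_
          have : (1 + C (b + c) * X - C (a ^ 2) * X ^ 2 : ℝ[X]).natDegree ≤ 2 := by compute_degree
          omega
        · rw [map_mul, norm_mul, mul_pow, aeval_I, pow_add, mul_comm]
          apply mul_le_mul _ (hqy y) (by positivity) (by positivity)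
          nlinarith [mul_nonneg (sq_nonneg (b + c)) (sq_nonneg y)]
        · have e : |((1 + C (b + c) * X - C (a ^ 2) * X ^ 2) * q).eval u| =
              |1 + (b + c) * u - a ^ 2 * u ^ 2| * |q.eval u| := by rw [← abs_mul]; simp
          rw [e]
          have hbu : |b * u| ≤ 1 / 4 := by
            rw [abs_mul, ← haD]; exact mul_le_mul hb.le hu (abs_nonneg _) ha0.le
          have hcu : |c * u| ≤ 1 / 4 := by
            rw [abs_mul, ← haD]; exact mul_le_mul hc hu (abs_nonneg _) ha0.le
          have hau : a ^ 2 * u ^ 2 ≤ 1 / 16 := by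
            have : a * |u| ≤ 1 / 4 := by rw [← haD]; exact mul_le_mul_of_nonneg_left hu ha0.le
            have h3 : (a * |u|) ^ 2 ≤ (1/4) ^ 2 := pow_le_pow_left₀ (by positivity) this 2
            rw [mul_pow, sq_abs] at h3; linarith
          have hbc : - a ^ 2 * u ^ 2 ≤ b * c * u ^ 2 := by
            apply mul_le_mul_of_nonneg_right _ (sq_nonneg u)
            have : |b * c| ≤ a * a := by
              rw [abs_mul]; exact mul_le_mul hb.le hc (abs_nonneg _) ha0.le
            have := neg_abs_le (b * c)
            linarith
          have g1 : |1 + (b + c) * u - a ^ 2 * u ^ 2| ≤ |1 + b * u| * |1 + c * u| := by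
            rw [← abs_mul]
            rw [abs_le] at hbu hcu
            rw [abs_of_nonneg (by nlinarith)]
            refine le_trans ?_ (le_abs_self _)
            nlinarith
          calc _ ≤ |1 + b * u| * |1 + c * u| * |q.eval u| :=
                mul_le_mul_of_nonneg_right g1 (abs_nonneg _)
            _ = |1 + b * u| * (|q.eval u| * |1 + c * u|) := by ring
            _ ≤ _ := mul_le_mul_of_nonneg_left (h2 u hu) (abs_nonneg _)

lemma surgery {D : ℝ} (hD : 0 < D) (P : ℝ[X]) (hP : P.eval 0 ≠ 0) :
    ∃ T : ℝ[X], T.natDegree ≤ P.natDegree ∧ (∀ u, |u| ≤ D → |T.eval u| ≤ |P.eval u| ) ∧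
     ∀ y : ℝ, P.eval 0 ^ 2 * (1 + (1 / (4 * D)) ^ 2 * y ^ 2) ^ (P.natDegree - 1) ≤
        ‖aeval (Complex.I * y) T‖ ^ 2 := by
  obtain ⟨t, ht, h⟩ := lin_factors P hP
  obtain ⟨q, hq0, d, hqd, hqy, h'⟩ := surgery_list hD t
  have hn : ∀ r : ℝ[X], ∀ y : ℝ, ‖aeval (Complex.I * y) (C (P.eval 0) * r)‖ ^ 2 =
      P.eval 0 ^ 2 * ‖aeval (Complex.I * y) r‖ ^ 2 := by
    intro r y; rw [map_mul, norm_mul, mul_pow, aeval_C]; simp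
  have hone : ∀ y : ℝ, 1 ≤ 1 + (1 / (4 * D)) ^ 2 * y ^ 2 := by intro y; nlinarith [sq_nonneg (1 / (4*D) * y)]
  rcases h' with ⟨h1, h2⟩ | ⟨h1, c, hc, h2⟩
  · refine ⟨C (P.eval 0) * q, (natDegree_C_mul_le _ _).trans (by omega), fun u hu => ?_, fun y => ?_⟩
    · rw [eval_mul, eval_C, abs_mul]
      exact (mul_le_mul_of_nonneg_left (h2 u hu) (abs_nonneg _)).trans (h u)
    · rw [hn]
      refine mul_le_mul_of_nonneg_left (le_trans ?_ (hqy y)) (sq_nonneg _)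
      exact pow_le_pow_right₀ (hone y) (by omega)
  · refine ⟨C (P.eval 0) * ((1 + C c * X - C 0 * X ^ 2) * q), (natDegree_C_mul_le _ _).trans ?_,
      fun u hu => ?_, fun y => ?_⟩
    · refine natDegree_mul_le.trans ?_
      have : (1 + C c * X - C 0 * X ^ 2 : ℝ[X]).natDegree ≤ 1 := by
        rw [C_0, zero_mul, sub_zero, add_comm, ← C_1]; exact natDegree_linear_le
      omega
    · rw [eval_mul, eval_C, abs_mul]
      refine (mul_le_mul_of_nonneg_left ?_ (abs_nonneg _)).trans (h u)
      refine le_trans (le_of_eq ?_) (h2 u hu)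
      rw [← abs_mul]; congr 1; simp; ring
    · rw [hn]
      refine mul_le_mul_of_nonneg_left ?_ (sq_nonneg _)
      rw [map_mul, norm_mul, mul_pow, aeval_I, show P.natDegree - 1 = d by omega]
      refine (hqy y).trans ?_
      refine le_mul_of_one_le_left (by positivity) ?_
      nlinarith [mul_nonneg (sq_nonneg c) (sq_nonneg y)]

end Fuchs

namespace Fuchs
open Polynomial

lemma arctan_le_self' {x : ℝ} (hx : 0 ≤ x) : arctan x ≤ x := by
  have h := Real.le_tan (arctan_nonneg.2 hx) (arctan_lt_pi_div_two x)
  rwa [tan_arctan] at h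

lemma arctan_sgn {u ρ D : ℝ} (hρ : 0 < ρ) (hu : u ≠ 0) (huD : |u| ≤ D) :
    |2 / π * arctan (ρ / u) - sgn u| ≤ D / ρ := by
  have hpi := Real.pi_gt_three
  have key : ∀ v : ℝ, 0 < v → v ≤ D → |2 / π * arctan (ρ / v) - 1| ≤ D / ρ := by
    intro v hv hvD
    have h1 : arctan (ρ / v) = π / 2 - arctan (v / ρ) := by
      rw [← arctan_inv_of_pos (by positivity), inv_div]
    have h2 := arctan_le_self' (x := v / ρ) (by positivity)
    have h3 : 0 ≤ arctan (v / ρ) := arctan_nonneg.2 (by positivity)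
    have e : 2 / π * arctan (ρ / v) - 1 = -(2 / π * arctan (v / ρ)) := by
      rw [h1]; field_simp; ring
    rw [e, abs_neg, abs_of_nonneg (by positivity)]
    have h4 : 2 / π ≤ 1 := by rw [div_le_one (by linarith)]; linarith
    have h5 : v / ρ ≤ D / ρ := by gcongr
    nlinarith
  unfold sgn
  rcases lt_or_gt_of_ne hu with h | h
  · rw [if_pos h]
    have := key (-u) (by linarith) (by rwa [abs_of_neg h] at huD)
    rw [div_neg, arctan_neg] at this
    rw [← abs_neg]
    convert this using 2; ring
  · rw [if_neg (by linarith)]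
    exact key u h (by rwa [abs_of_pos h] at huD)

lemma int_le_pi {s ρ : ℝ} (hs : 0 < s) :
    ∫ y in (-ρ)..ρ, 1 / (1 + s ^ 2 * y ^ 2) ≤ π / s := by
  have h1 : ∀ y : ℝ, 1 / (1 + s ^ 2 * y ^ 2) = (s⁻¹) ^ 2 * ((s⁻¹) ^ 2 + y ^ 2)⁻¹ := by
    intro y
    have : 0 < 1 + s ^ 2 * y ^ 2 := by positivity
    have : 0 < s⁻¹ ^ 2 + y ^ 2 := by positivity
    field_simp
  simp only [h1]
  rw [intervalIntegral.integral_const_mul, integral_inv_sq_add_sq (by positivity)]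
  have h2 := arctan_lt_pi_div_two (ρ / s⁻¹)
  have h3 := neg_pi_div_two_lt_arctan (-ρ / s⁻¹)
  have : s⁻¹ ^ 2 * (s⁻¹⁻¹ * (arctan (ρ / s⁻¹) - arctan (-ρ / s⁻¹))) =
      (arctan (ρ / s⁻¹) - arctan (-ρ / s⁻¹)) / s := by field_simp
  rw [this]
  gcongr
  linarith

/-- The approximating polynomial (in the shifted variable). -/
lemma approx_poly {T : ℝ[X]} {m j : ℕ} {τ t0 D d0 M ρ : ℝ} (hT : T.natDegree ≤ m) (hm : 1 ≤ m)
    (hj : 0 < j) (hτ : 0 < τ) (ht0 : 0 < t0) (hρ : 0 < ρ)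
    (hTy : ∀ y : ℝ, τ * (1 + j * t0 * y ^ 2) ≤ ‖aeval (Complex.I * y) T‖)
    (hd0 : 0 < d0) : ∃ p : ℝ[X], p.natDegree ≤ m - 1 ∧ ∀ u : ℝ, d0 ≤ |u| → |u| ≤ D →
      |T.eval u| ≤ M → |sgn u - p.eval u| ≤ D / ρ + M / (d0 * √(j * t0) * τ) := by
  set Tc := T.map (algebraMap ℝ ℂ) with hTc
  have hev : ∀ u : ℝ, Tc.eval (u:ℂ) = ((T.eval u : ℝ) : ℂ) := by
    intro u; rw [hTc, eval_map_algebraMap]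
    exact (Polynomial.aeval_algebraMap_apply_eq_algebraMap_eval (A := ℂ) u T)
  have hTy' : ∀ y : ℝ, τ * (1 + j * t0 * y ^ 2) ≤ ‖Tc.eval (Complex.I * y)‖ := by
    intro y; rw [hTc, eval_map_algebraMap]; exact hTy y
  have hTpos : ∀ y : ℝ, 0 < τ * (1 + j * t0 * y ^ 2) := by intro y; positivity
  have hTne : ∀ y : ℝ, Tc.eval (Complex.I * y) ≠ 0 := by
    intro y h0
    have := hTy' y
    rw [h0, norm_zero] at this
    linarith [hTpos y]
  set cf : ℕ → ℝ → ℝ := fun i y =>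
    ((Tc /ₘ (X - C (Complex.I * y))).coeff i / Tc.eval (Complex.I * y)).re with hcf
  have hcfc : ∀ i, Continuous (cf i) := by
    intro i
    simp only [hcf, coeff_divByMonic_X_sub_C]
    apply Complex.continuous_re.comp
    apply Continuous.div
    · fun_prop
    · fun_prop
    · exact hTne
  set p : ℝ[X] := ∑ i ∈ Finset.range m, C (-(1 / π) * ∫ y in (-ρ)..ρ, cf i y) * X ^ i with hp
  refine ⟨p, ?_, fun u hu1 hu2 hM => ?_⟩
  · refine natDegree_sum_le_of_forall_le _ _ fun i hi => ?_
    refine (natDegree_C_mul_X_pow_le _ _).trans ?_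
    have := Finset.mem_range.1 hi; omega
  have hu : u ≠ 0 := by rintro rfl; simp at hu1; linarith
  have huz : ∀ y : ℝ, (u:ℂ) - Complex.I * y ≠ 0 := by
    intro y h0
    have := congrArg Complex.re h0
    simp at this; exact hu this
  have hsum : ∀ y : ℝ, ∑ i ∈ Finset.range m, cf i y * u ^ i =
      T.eval u * (1 / (((u:ℂ) - Complex.I * y) * Tc.eval (Complex.I * y))).re - u / (u ^ 2 + y ^ 2) := by
    intro y
    set z := Complex.I * (y:ℂ) with hz
    set q := Tc /ₘ (X - C z) with hq
    have hqd : q.natDegree < m := by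
      rw [hq, natDegree_divByMonic _ (monic_X_sub_C z), natDegree_X_sub_C, hTc, natDegree_map]
      omega
    have e1 : ((u:ℂ) - z) * q.eval (u:ℂ) = Tc.eval (u:ℂ) - Tc.eval z := by
      have := X_sub_C_mul_divByMonic_eq_sub_modByMonic Tc z
      rw [modByMonic_X_sub_C_eq_C_eval] at this
      have := congrArg (eval (u:ℂ)) this
      simpa using this
    have e2 : ((∑ i ∈ Finset.range m, cf i y * u ^ i : ℝ)) = (q.eval (u:ℂ) / Tc.eval z).re := by
      rw [eval_eq_sum_range' hqd, Finset.sum_div, Complex.re_sum]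
      refine Finset.sum_congr rfl fun i _ => ?_
      simp only [hcf]
      rw [mul_comm, ← Complex.re_ofReal_mul]
      congr 1
      push_cast
      ring
    have e3 : q.eval (u:ℂ) / Tc.eval z = ((T.eval u : ℝ) : ℂ) * (1 / (((u:ℂ) - z) * Tc.eval z)) -
        1 / ((u:ℂ) - z) := by
      have h1 := huz y
      have h2 := hTne y
      rw [← hz] at h1 h2
      rw [← hev]
      field_simp
      rw [mul_comm, e1]
    rw [e2, e3, Complex.sub_re, Complex.re_ofReal_mul]
    congr 1
    rw [one_div, Complex.inv_re, Complex.normSq_apply, hz]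
    simp
    ring
  set g : ℝ → ℝ := fun y => (1 / (((u:ℂ) - Complex.I * y) * Tc.eval (Complex.I * y))).re with hg
  have hgc : Continuous g := by
    apply Complex.continuous_re.comp
    apply Continuous.div
    · fun_prop
    · fun_prop
    · intro y; exact mul_ne_zero (huz y) (hTne y)
  have hc2 : Continuous fun y : ℝ => u / (u ^ 2 + y ^ 2) := by
    apply Continuous.div (by fun_prop) (by fun_prop)
    intro y; positivity
  have hpe : p.eval u = 2 / π * arctan (ρ / u) - T.eval u / π * ∫ y in (-ρ)..ρ, g y := by
    have e1 : p.eval u = -(1 / π) * ∫ y in (-ρ)..ρ, ∑ i ∈ Finset.range m, cf i y * u ^ i := by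
      rw [intervalIntegral.integral_finsetSum, hp, eval_finsetSum, Finset.mul_sum]
      · refine Finset.sum_congr rfl fun i _ => ?_
        rw [intervalIntegral.integral_mul_const]
        simp; ring
      · intro i _
        exact ((hcfc i).mul continuous_const).intervalIntegrable _ _
    rw [e1]
    simp only [hsum]
    rw [intervalIntegral.integral_sub, intervalIntegral.integral_const_mul, integral_div_sq_add_sq]
    · rw [neg_div, arctan_neg]; ring
    · exact (continuous_const.mul hgc).intervalIntegrable _ _
    · exact hc2.intervalIntegrable _ _
  set s := √(j * t0) with hs
  have hjt : 0 < j * t0 := by positivity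
  have hs0 : 0 < s := Real.sqrt_pos.2 hjt
  have hs2 : s ^ 2 = j * t0 := Real.sq_sqrt hjt.le
  have hI : |∫ y in (-ρ)..ρ, g y| ≤ (1 / (d0 * τ)) * (π / s) := by
    have h1 : ‖∫ y in (-ρ)..ρ, g y‖ ≤ ∫ y in (-ρ)..ρ, 1 / (d0 * τ) * (1 / (1 + s ^ 2 * y ^ 2)) := by
      apply intervalIntegral.norm_integral_le_of_norm_le (by linarith)
      · refine Eventually.of_forall fun y _ => ?_
        rw [hg, Real.norm_eq_abs]
        refine (Complex.abs_re_le_norm _).trans ?_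
        rw [norm_div, norm_one, norm_mul, ← one_div_mul_one_div_rev, hs2]
        have a1 : d0 ≤ ‖(u:ℂ) - Complex.I * y‖ := by
          refine hu1.trans ?_
          have := Complex.abs_re_le_norm ((u:ℂ) - Complex.I * y)
          simpa using this
        have a2 := hTy' y
        rw [one_div_mul_one_div, one_div_mul_one_div]
        apply one_div_le_one_div_of_le
        · have := hTpos y; positivity
        · calc d0 * τ * (1 + j * t0 * y ^ 2) = (τ * (1 + j * t0 * y ^ 2)) * d0 := by ring
            _ ≤ _ := mul_le_mul a2 a1 hd0.le (norm_nonneg _)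
      · apply Continuous.intervalIntegrable
        apply Continuous.mul (by fun_prop)
        apply Continuous.div (by fun_prop) (by fun_prop)
        intro y; positivity
    rw [intervalIntegral.integral_const_mul] at h1
    rw [← Real.norm_eq_abs]
    exact h1.trans (mul_le_mul_of_nonneg_left (int_le_pi hs0) (by positivity))
  have h1 := arctan_sgn hρ hu hu2
  have hM0 : 0 ≤ M := (abs_nonneg _).trans hM
  rw [hpe]
  have e : sgn u - (2 / π * arctan (ρ / u) - T.eval u / π * ∫ y in (-ρ)..ρ, g y) =
    -(2 / π * arctan (ρ / u) - sgn u) + T.eval u / π * ∫ y in (-ρ)..ρ, g y := by ring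
  rw [e]
  refine (abs_add_le _ _).trans (add_le_add (by rwa [abs_neg]) ?_)
  rw [abs_mul, abs_div, abs_of_pos Real.pi_pos]
  calc |T.eval u| / π * |∫ y in (-ρ)..ρ, g y| ≤ M / π * ((1 / (d0 * τ)) * (π / s)) := by gcongr
    _ = _ := by have := Real.pi_pos; field_simp

lemma bestErr_le {A B e : ℝ} {n : ℕ} (p : ℝ[X]) (hp : p.natDegree ≤ n) (he : 0 ≤ e)
    (h : ∀ x ∈ Icc (-A) (-1) ∪ Icc 1 B, |sgn x - p.eval x| ≤ e) : bestErr A B n ≤ e := by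
  unfold bestErr
  refine le_trans (csInf_le (a := 0 + sSup ((fun x => |sgn x - p.eval x|) '' (Icc (-A) (-1) ∪ Icc 1 B)))
    ⟨0, ?_⟩ ⟨p, natDegree_le_iff_degree_le.1 hp, zero_add _⟩) ?_
  · rintro _ ⟨q, _, rfl⟩
    apply Real.sSup_nonneg
    rintro _ ⟨x, _, rfl⟩; exact abs_nonneg _
  · rw [zero_add]
    apply Real.sSup_le _ he
    rintro _ ⟨x, hx, rfl⟩; exact h x hx

lemma upper_abs {A B c : ℝ} (hA : 1 < A) (hB : 1 < B) (hc : c ∈ Ioo (-1:ℝ) 1) : ∃ K > 0,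
    ∀ (P : ℝ[X]) (M : ℝ) (n : ℕ), 3 ≤ n → n ≤ P.natDegree → P.natDegree ≤ n + 1 → 0 ≤ M →
    P.eval c ≠ 0 → (∀ x ∈ Icc (-A) (-1) ∪ Icc 1 B, |P.eval x| ≤ M) →
    bestErr A B n ≤ K * M / (√n * |P.eval c|) := by
  set D := A + B + 1 with hD
  have hD0 : 0 < D := by linarith
  set t0 := (1 / (4 * D)) ^ 2 with ht0
  have ht00 : 0 < t0 := by positivity
  set d0 := min (1 - c) (1 + c) with hd0
  have hd00 : 0 < d0 := lt_min (by linarith [hc.2]) (by linarith [hc.1])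
  refine ⟨1 / (d0 * √(t0 / 6)), by positivity, ?_⟩
  intro P M n hn h1 h2 hM hPc hPM
  set m := P.natDegree with hm
  set P' := P.comp (X + C c) with hP'
  have hP'd : P'.natDegree = m := by rw [hP', natDegree_comp, natDegree_X_add_C, mul_one]
  have hP'e : ∀ u, P'.eval u = P.eval (u + c) := by intro u; simp [hP']
  have hP'0 : P'.eval 0 = P.eval c := by rw [hP'e, zero_add]
  obtain ⟨T, hTd, hTu, hTy⟩ := surgery hD0 P' (by rwa [hP'0])
  rw [hP'd] at hTd hTy
  rw [hP'0] at hTy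
  set τ := |P.eval c| with hτ
  have hτ0 : 0 < τ := abs_pos.2 hPc
  set j := (m - 1) / 2 with hj
  have hj0 : 0 < j := by omega
  have hjn : (n:ℝ) / 6 ≤ j := by
    have : n ≤ 6 * j := by omega
    have : (n:ℝ) ≤ 6 * j := by exact_mod_cast this
    linarith
  have hTy2 : ∀ y : ℝ, τ * (1 + j * t0 * y ^ 2) ≤ ‖aeval (Complex.I * y) T‖ := by
    intro y
    apply le_of_sq_le_sq _ (norm_nonneg _)
    refine le_trans ?_ (hTy y)
    rw [mul_pow, hτ, sq_abs]
    apply mul_le_mul_of_nonneg_left _ (sq_nonneg _)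
    have b1 : 1 + j * t0 * y ^ 2 ≤ (1 + t0 * y ^ 2) ^ j := by
      have := one_add_mul_le_pow (a := t0 * y ^ 2) (by nlinarith [mul_nonneg ht00.le (sq_nonneg y)]) j
      linarith
    calc (1 + j * t0 * y ^ 2) ^ 2 ≤ ((1 + t0 * y ^ 2) ^ j) ^ 2 := by
          apply pow_le_pow_left₀ _ b1; positivity
      _ = (1 + t0 * y ^ 2) ^ (j * 2) := by rw [pow_mul]
      _ ≤ _ := by
        apply pow_le_pow_right₀
        · nlinarith [mul_nonneg ht00.le (sq_nonneg y)]
        · omega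
  have hfin : M / (d0 * √(j * t0) * τ) ≤ 1 / (d0 * √(t0 / 6)) * M / (√n * τ) := by
    have : √(n:ℝ) * √(t0 / 6) ≤ √(j * t0) := by
      rw [← Real.sqrt_mul (by positivity)]
      apply Real.sqrt_le_sqrt
      nlinarith
    have hn0 : 0 < √(n:ℝ) := by apply Real.sqrt_pos.2; exact_mod_cast (by omega)
    have hs0 : 0 < √(t0 / 6) := by positivity
    calc M / (d0 * √(j * t0) * τ) ≤ M / (d0 * (√(n:ℝ) * √(t0 / 6)) * τ) := by gcongr
      _ = _ := by field_simp
  refine le_trans ?_ hfin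
  refine le_of_forall_pos_le_add fun ε hε => ?_
  obtain ⟨p, hpd, hp⟩ := approx_poly (D := D) (M := M) (ρ := D / ε) hTd (by omega) hj0 hτ0 ht00
    (by positivity) hTy2 hd00
  have hDe : D / (D / ε) = ε := by field_simp
  refine bestErr_le (p.comp (X - C c)) ?_ (by positivity) fun x hx => ?_
  · rw [natDegree_comp, natDegree_X_sub_C]; omega
  · have e1 : (p.comp (X - C c)).eval x = p.eval (x - c) := by simp
    have hcx : d0 ≤ |x - c| ∧ |x - c| ≤ D ∧ sgn x = sgn (x - c) := by
      have m1 : d0 ≤ 1 - c := min_le_left _ _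
      have m2 : d0 ≤ 1 + c := min_le_right _ _
      have := hc.1; have := hc.2
      unfold sgn
      rcases hx with hx | hx
      · have := hx.1; have := hx.2
        rw [abs_of_neg (by linarith), if_pos (by linarith), if_pos (by linarith)]
        exact ⟨by linarith, by linarith, rfl⟩
      · have := hx.1; have := hx.2
        rw [abs_of_pos (by linarith), if_neg (by linarith), if_neg (by linarith)]
        exact ⟨by linarith, by linarith, rfl⟩
    rw [e1, hcx.2.2, add_comm, ← hDe]
    have := hp (x - c) hcx.1 hcx.2.1 ((hTu _ hcx.2.1).trans (by rw [hP'e, sub_add_cancel]; exact hPM x hx))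
    simpa [hDe] using this

end Fuchs

namespace Fuchs
open Polynomial

lemma rpow_half (n : ℕ) : (n:ℝ) ^ (-(1:ℝ)/2) = 1 / √n := by
  rw [neg_div, Real.rpow_neg (by positivity), ← Real.sqrt_eq_rpow, one_div]

lemma eta_nonneg {A B : ℝ} (hA : 1 < A) (hB : 1 < B) : 0 ≤ eta A B := by
  obtain ⟨c, hc, h⟩ := Gg_le hA hB
  have := h (-1) (by norm_num)
  have h0 : Gg A B (-1) = 0 := by simp [Gg]
  rw [h0] at this
  nlinarith [mul_nonneg hc.le (sq_nonneg (-1 - Ccrit A B))]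

lemma Rp_nonpos {A B x : ℝ} (hA : 1 < A) (hB : 1 < B) (hx : x ∈ Icc (-A) (-1) ∪ Icc 1 B) :
    (Rp A B).eval x ≤ 0 := by
  rw [Rp_eval]
  rcases hx with hx | hx
  · have h1 : 0 ≤ x + A := by linarith [hx.1]
    have h2 : 0 ≤ x ^ 2 - 1 := by nlinarith [hx.2]
    have h3 : x - B ≤ 0 := by linarith [hx.2]
    exact mul_nonpos_of_nonneg_of_nonpos (mul_nonneg h1 h2) h3
  · have h1 : 0 ≤ x + A := by linarith [hx.1]
    have h2 : 0 ≤ x ^ 2 - 1 := by nlinarith [hx.1]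
    have h3 : x - B ≤ 0 := by linarith [hx.2]
    exact mul_nonpos_of_nonneg_of_nonpos (mul_nonneg h1 h2) h3

lemma ell_le_E {A B α x : ℝ} (hA : 1 < A) (hB : 1 < B) (h1 : 0 ≤ 1 + α * B) (h2 : 0 ≤ 1 - α * A)
    (hx : x ∈ Icc (-A) (-1) ∪ Icc 1 B) : 1 + α * x ≤ 1 + A + B := by
  have hα := (ell_ge (x := 0) hA hB h1 h2 (by norm_num)).2.2
  rw [abs_le] at hα
  rcases hx with hx | hx
  · have := hx.1; have := hx.2; nlinarith
  · have := hx.1; have := hx.2; nlinarith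

lemma upper_bound {A B : ℝ} (hA : 1 < A) (hB : 1 < B) : ∃ C₂ > 0, ∀ n : ℕ, 1 ≤ n →
    bestErr A B n ≤ C₂ * (n:ℝ) ^ (-(1:ℝ)/2) * Real.exp (-(eta A B) * n) := by
  obtain ⟨K, hK⟩ := KP hA hB
  obtain ⟨K1, hK1, hup⟩ := upper_abs hA hB (Ccrit_mem hA hB)
  set η := eta A B with hη
  have hη0 : 0 ≤ η := eta_nonneg hA hB
  set M := √(1 + A + B) with hM
  set κ := kap A B with hκ
  have hκ0 : 0 < κ := kap_pos hA hB
  set c := Ccrit A B with hc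
  have hc' : c ∈ Icc (-1:ℝ) 1 := Ioo_subset_Icc_self (Ccrit_mem hA hB)
  refine ⟨K1 * M / (κ / 2 * Real.exp (-K)) + 2 * Real.exp (2 * η), by positivity, fun n hn => ?_⟩
  rw [rpow_half]
  have hn0 : (0:ℝ) < n := by exact_mod_cast hn
  have hsn : 0 < √(n:ℝ) := Real.sqrt_pos.2 hn0
  by_cases h3 : 3 ≤ n
  · obtain ⟨P, Q, α, m, hm1, hm2, hp⟩ := Pell.exists hA hB (n + 1) (by omega)
    have hPE : ∀ x ∈ Icc (-A) (-1) ∪ Icc 1 B, |P.eval x| ≤ M := by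
      intro x hx
      apply Real.abs_le_sqrt
      have e1 := hp.eval_eq x
      have e2 := ell_le_E hA hB hp.h1 hp.h2 hx
      have e3 := Rp_nonpos hA hB hx
      nlinarith [mul_nonneg (neg_nonneg.2 e3) (sq_nonneg (Q.eval x))]
    have hPc : κ / 2 * Real.exp (-K) * Real.exp (η * n) ≤ |P.eval c| := by
      have h1 := hK P Q α m hp c hc'
      rw [hc, Gg_C, ← hc] at h1
      have hF := FF_ne hA hB hp hc'
      have hmul := FF_mul hA hB hp hc'
      have hell := (ell_ge hA hB hp.h1 hp.h2 hc').1
      rw [← hκ] at hell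
      set F := FF A B P Q c with hF'
      set F2 := P.eval c - Q.eval c * √((Rp A B).eval c) with hF2
      have hsum : F + F2 = 2 * P.eval c := by rw [hF', FF, hF2]; ring
      have hFle : |F| ≤ Real.exp (K - m * η) := by
        rw [← Real.exp_log (abs_pos.2 hF), Real.log_abs]
        apply Real.exp_le_exp.2
        linarith [(abs_le.1 h1).2]
      have hF2ge : κ * Real.exp (m * η - K) ≤ |F2| := by
        have h2 : κ ≤ |F| * |F2| := by rw [← abs_mul, hmul]; exact hell.trans (le_abs_self _)
        have h3 : |F| * |F2| ≤ Real.exp (K - m * η) * |F2| :=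
          mul_le_mul_of_nonneg_right hFle (abs_nonneg _)
        have h4 : Real.exp (m * η - K) * Real.exp (K - m * η) = 1 := by
          rw [← Real.exp_add]; simp
        calc κ * Real.exp (m * η - K) ≤ (Real.exp (K - m * η) * |F2|) * Real.exp (m * η - K) :=
              mul_le_mul_of_nonneg_right (h2.trans h3) (Real.exp_pos _).le
          _ = (Real.exp (m * η - K) * Real.exp (K - m * η)) * |F2| := by ring
          _ = |F2| := by rw [h4, one_mul]
      have hF2le : |F2| ≤ 2 * |P.eval c| := by
        have : |F2| ≤ |F + F2| := by
          have hpos : 0 < F * F2 := by rw [hmul]; linarith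
          apply sq_le_sq.1
          nlinarith [sq_nonneg F]
        rwa [hsum, abs_mul, abs_of_pos (by norm_num : (0:ℝ) < 2)] at this
      have hmn : η * n - K ≤ m * η - K := by
        have : (n:ℝ) ≤ m := by exact_mod_cast (by omega : n ≤ m)
        nlinarith
      have := Real.exp_le_exp.2 hmn
      rw [mul_assoc, ← Real.exp_add, neg_add_eq_sub]
      nlinarith
    have hpos : 0 < |P.eval c| := lt_of_lt_of_le (by positivity) hPc
    have h := hup P M n h3 (by rw [hp.hP]; omega) (by rw [hp.hP]; omega) (Real.sqrt_nonneg _)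
      (abs_pos.1 hpos) hPE
    calc bestErr A B n ≤ K1 * M / (√n * |P.eval c|) := h
      _ ≤ K1 * M / (√n * (κ / 2 * Real.exp (-K) * Real.exp (η * n))) := by gcongr
      _ = K1 * M / (κ / 2 * Real.exp (-K)) * (1 / √n) * Real.exp (-η * n) := by
        rw [neg_mul]; field_simp; rw [mul_assoc, ← Real.exp_add]; simp
      _ ≤ _ := by
        gcongr
        have := Real.exp_pos (2 * η)
        linarith
  · have hb : bestErr A B n ≤ 1 := by
      apply bestErr_le 0 (by simp) (by norm_num)
      intro x _
      simp only [eval_zero, sub_zero, sgn]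
      split_ifs <;> simp
    have hn2 : (n:ℝ) ≤ 2 := by exact_mod_cast (by omega : n ≤ 2)
    have hs2 : √(n:ℝ) ≤ 2 := by
      rw [Real.sqrt_le_left (by norm_num)]; linarith
    have h1 : 1 ≤ 2 * Real.exp (2 * η) * (1 / √n) * Real.exp (-η * n) := by
      have e1 : 1 ≤ 2 * (1 / √(n:ℝ)) := by
        rw [mul_one_div, le_div_iff₀ hsn]; linarith
      have e2 : 1 ≤ Real.exp (2 * η) * Real.exp (-η * n) := by
        rw [← Real.exp_add]; apply Real.one_le_exp; nlinarith
      nlinarith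
    refine hb.trans (h1.trans ?_)
    gcongr
    have : 0 ≤ K1 * M / (κ / 2 * Real.exp (-K)) := by positivity
    linarith

end Fuchs

namespace Fuchs
open Polynomial

noncomputable def hJ (q : ℝ[X]) (n : ℕ) (w : ℂ) : ℂ :=
  ∑ k ∈ Finset.range (n+1), ((q.coeff k : ℝ) : ℂ) / 2^k * w^(n-k) * (w^2+1)^k

lemma hJ_eq (q : ℝ[X]) (n : ℕ) (hq : q.natDegree ≤ n) (w : ℂ) (hw : w ≠ 0) :
    hJ q n w = w^n * (q.map (algebraMap ℝ ℂ)).eval ((w + w⁻¹)/2) := by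
  rw [Polynomial.eval_eq_sum_range' (n := n+1) (by
    rw [Polynomial.natDegree_map]; omega)]
  unfold hJ
  rw [Finset.mul_sum]
  refine Finset.sum_congr rfl fun k hk => ?_
  have hk' : k ≤ n := by simp at hk; omega
  obtain ⟨j, rfl⟩ := Nat.exists_eq_add_of_le hk'
  have : (w + w⁻¹)/2 = (w^2+1)/(2*w) := by field_simp
  rw [this, Polynomial.coeff_map]
  simp only [Complex.coe_algebraMap, add_tsub_cancel_left, div_pow, mul_pow]
  field_simp
  ring

lemma hJ_diff (q : ℝ[X]) (n : ℕ) : Differentiable ℂ (hJ q n) := by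
  unfold hJ
  fun_prop

lemma joukowski_unit (w : ℂ) (hw : ‖w‖ = 1) : (w + w⁻¹)/2 = ((w.re : ℝ) : ℂ) := by
  have : w⁻¹ = (starRingEnd ℂ) w := by
    rw [Complex.inv_def, Complex.normSq_eq_norm_sq, hw]; simp
  rw [this, Complex.add_conj]; push_cast; ring

lemma map_eval_real (q : ℝ[X]) (x : ℝ) :
    (q.map (algebraMap ℝ ℂ)).eval (x:ℂ) = ((q.eval x : ℝ) : ℂ) := by
  rw [Polynomial.eval_map, ← Complex.coe_algebraMap, Polynomial.eval₂_at_apply]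

lemma hJ_disc (q : ℝ[X]) (n : ℕ) (L : ℝ) (hq : q.natDegree ≤ n)
    (hL : ∀ x ∈ Icc (-1:ℝ) 1, |q.eval x| ≤ L) (w : ℂ) (hw : ‖w‖ ≤ 1) : ‖hJ q n w‖ ≤ L := by
  refine Complex.norm_le_of_forall_mem_frontier_norm_le (U := Metric.ball 0 1)
    Metric.isBounded_ball (hJ_diff q n).diffContOnCl ?_ ?_
  · intro z hz
    rw [frontier_ball _ one_ne_zero] at hz
    have hz1 : ‖z‖ = 1 := by simpa using hz
    have h0 : z ≠ 0 := by rintro rfl; simp at hz1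
    rw [hJ_eq q n hq z h0, joukowski_unit z hz1, map_eval_real, norm_mul, norm_pow, hz1]
    simp only [one_pow, one_mul, Complex.norm_real, Real.norm_eq_abs]
    apply hL
    have := Complex.abs_re_le_norm z
    rw [hz1] at this
    exact abs_le.mp this
  · rw [closure_ball _ one_ne_zero]; simpa using hw

lemma hJ_out (q : ℝ[X]) (n : ℕ) (L : ℝ) (hq : q.natDegree ≤ n)
    (hL : ∀ x ∈ Icc (-1:ℝ) 1, |q.eval x| ≤ L) (w : ℂ) (hw : 1 ≤ ‖w‖) :
    ‖hJ q n w‖ ≤ L * ‖w‖^(2*n) := by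
  have h0 : w ≠ 0 := by rintro rfl; simp at hw; linarith
  have e : hJ q n w = w^(2*n) * hJ q n w⁻¹ := by
    rw [hJ_eq q n hq w h0, hJ_eq q n hq _ (inv_ne_zero h0), inv_inv, add_comm w⁻¹ w, two_mul,
      pow_add, inv_pow]
    field_simp
  rw [e, norm_mul, norm_pow, mul_comm]
  gcongr
  apply hJ_disc q n L hq hL
  rw [norm_inv]
  exact inv_le_one_of_one_le₀ hw

lemma bernstein_unit (q : ℝ[X]) (n : ℕ) (hn : 1 ≤ n) (L : ℝ) (hq : q.natDegree ≤ n)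
    (hL : ∀ x ∈ Icc (-1:ℝ) 1, |q.eval x| ≤ L) (x : ℝ) (hx : x ∈ Icc (-1:ℝ) 1) :
    √(1 - x^2) * |q.derivative.eval x| ≤ 9 * n * L := by
  have hn0 : (0:ℝ) < n := by exact_mod_cast hn
  have hL0 : 0 ≤ L := le_trans (abs_nonneg _) (hL 0 (by norm_num))
  have hx1 : 0 ≤ 1 - x^2 := by nlinarith [hx.1, hx.2]
  set w : ℂ := ⟨x, √(1-x^2)⟩ with hwdef
  have hw1 : ‖w‖ = 1 := by
    rw [Complex.norm_def, Complex.normSq_mk, Real.mul_self_sqrt hx1]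
    have : x*x + (1 - x^2) = 1 := by ring
    rw [this, Real.sqrt_one]
  have h0 : w ≠ 0 := by intro h; rw [h] at hw1; simp at hw1
  have hc : ‖deriv (hJ q n) w‖ ≤ L * Real.exp 2 / (1/n) := by
    refine Complex.norm_deriv_le_of_forall_mem_sphere_norm_le (by positivity)
      (hJ_diff q n).diffContOnCl ?_
    intro z hz
    have hz' : ‖z - w‖ = 1/n := by simpa [dist_eq_norm] using hz
    have hzn : ‖z‖ ≤ 1 + 1/n := by
      have := norm_add_le (z - w) w
      rw [sub_add_cancel, hz', hw1] at this; linarith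
    rcases le_total ‖z‖ 1 with h | h
    · refine (hJ_disc q n L hq hL z h).trans ?_
      have : (1:ℝ) ≤ Real.exp 2 := Real.one_le_exp (by norm_num)
      nlinarith
    · refine (hJ_out q n L hq hL z h).trans ?_
      gcongr
      calc ‖z‖^(2*n) ≤ (Real.exp (1/n))^(2*n) := by
            gcongr
            refine hzn.trans ?_
            have := Real.add_one_le_exp (1/(n:ℝ)); linarith
        _ = Real.exp 2 := by
            rw [← Real.exp_nat_mul]; congr 1; push_cast; field_simp
  have hd : HasDerivAt (hJ q n) ((n:ℂ) * w^(n-1) * (q.map (algebraMap ℝ ℂ)).eval ((w + w⁻¹)/2)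
      + w^n * ((q.map (algebraMap ℝ ℂ)).derivative.eval ((w + w⁻¹)/2) * ((1 + -(w^2)⁻¹)/2))) w := by
    have h1 : HasDerivAt (fun z : ℂ => (z + z⁻¹)/2) ((1 + -(w^2)⁻¹)/2) w :=
      ((hasDerivAt_id w).add (hasDerivAt_inv h0)).div_const 2
    have h2 := ((q.map (algebraMap ℝ ℂ)).hasDerivAt ((w + w⁻¹)/2)).comp w h1
    have h3 := (hasDerivAt_pow n w).mul h2
    refine h3.congr_of_eventuallyEq ?_
    filter_upwards [isOpen_ne.mem_nhds h0] with z hz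
    exact hJ_eq q n hq z hz
  rw [hd.deriv, joukowski_unit w hw1, Polynomial.derivative_map, map_eval_real, map_eval_real] at hc
  have hre : w.re = x := rfl
  rw [hre] at hc
  have hs : ‖(1 + -(w^2)⁻¹)/2‖ = √(1-x^2) := by
    have hi : w⁻¹ = (starRingEnd ℂ) w := by
      rw [Complex.inv_def, Complex.normSq_eq_norm_sq, hw1]; simp
    have : (1 + -(w^2)⁻¹)/2 = w⁻¹ * ((w - w⁻¹)/2) := by field_simp; ring
    rw [this, norm_mul, norm_inv, hw1, hi, Complex.sub_conj]
    have him : w.im = √(1-x^2) := rfl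
    rw [him]
    simp [abs_of_nonneg (Real.sqrt_nonneg _)]
  have t1 : ‖w^n * (((q.derivative.eval x : ℝ):ℂ) * ((1 + -(w^2)⁻¹)/2))‖
      = √(1 - x^2) * |q.derivative.eval x| := by
    rw [norm_mul, norm_mul, hs, norm_pow, hw1, Complex.norm_real, Real.norm_eq_abs]; ring
  have t2 : ‖(n:ℂ) * w^(n-1) * ((q.eval x : ℝ):ℂ)‖ ≤ n * L := by
    rw [norm_mul, norm_mul, norm_pow, hw1, Complex.norm_real, Real.norm_eq_abs]
    simp only [Complex.norm_natCast, one_pow, mul_one]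
    gcongr
    exact hL x hx
  rw [← t1]
  have t3 := norm_sub_le ((n:ℂ) * w^(n-1) * ((q.eval x : ℝ):ℂ) + w^n * (((q.derivative.eval x : ℝ):ℂ) * ((1 + -(w^2)⁻¹)/2))) ((n:ℂ) * w^(n-1) * ((q.eval x : ℝ):ℂ))
  rw [add_sub_cancel_left] at t3
  have he : Real.exp 2 ≤ 8 := by
    have : Real.exp 2 = Real.exp 1 ^ 2 := by rw [← Real.exp_nat_mul]; norm_num
    rw [this]; nlinarith [Real.exp_one_lt_d9, Real.exp_pos 1]
  have : L * Real.exp 2 / (1/n) ≤ 8 * n * L := by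
    rw [div_div_eq_mul_div, div_one]
    have := mul_le_mul_of_nonneg_left he (mul_nonneg hn0.le hL0)
    nlinarith
  nlinarith

/-- crude Markov at the right end point -/
lemma markov_end (q : ℝ[X]) (n : ℕ) (L : ℝ) (hL0 : 0 < L) (hq : q.natDegree ≤ n)
    (hL : ∀ x ∈ Icc (-1:ℝ) 1, |q.eval x| ≤ L) : |q.derivative.eval 1| ≤ n^2 * L := by
  have key : ∀ r : ℝ[X], r.natDegree ≤ n → (∀ x ∈ Icc (-1:ℝ) 1, |r.eval x| ≤ L) →
      r.derivative.eval 1 ≤ n^2 * L := by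
    intro r hr hb
    have := Polynomial.Chebyshev.eval_iterate_derivative_le_of_forall_abs_le_one (n := n) (P := C L⁻¹ * r) (k := 1) (x := 1) le_rfl
      ((Polynomial.degree_le_of_natDegree_le ((Polynomial.natDegree_C_mul_le _ _).trans hr))) (by
        intro x hx
        rw [eval_mul, eval_C, abs_mul, abs_of_pos (inv_pos.mpr hL0), inv_mul_le_iff₀ hL0, mul_one]
        exact hb x hx)
    simp only [Function.iterate_one, derivative_C_mul, eval_mul, eval_C,
      Polynomial.Chebyshev.derivative_T_eval_one] at this
    rw [inv_mul_le_iff₀ hL0] at this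
    push_cast at this
    linarith
  rw [abs_le]
  constructor
  · have := key (-q) (by rwa [natDegree_neg]) (by simpa using hL)
    simp at this
    linarith
  · exact key q hq hL

/-- affine Markov at endpoint u of the segment [u,v] (either orientation) -/
lemma markov_seg (q : ℝ[X]) (n : ℕ) (L : ℝ) (hL0 : 0 < L) (hq : q.natDegree ≤ n) (u v : ℝ)
    (huv : u ≠ v) (hL : ∀ x ∈ uIcc u v, |q.eval x| ≤ L) :
    |q.derivative.eval u| ≤ 2 * n^2 * L / |u - v| := by
  have h := markov_end (q.comp (C ((u-v)/2) * X + C ((u+v)/2))) n L hL0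
    (by
      rw [natDegree_comp]
      have : (C ((u-v)/2) * X + C ((u+v)/2) : ℝ[X]).natDegree ≤ 1 := natDegree_linear_le
      nlinarith)
    (by
      intro x hx
      rw [eval_comp]
      apply hL
      simp only [eval_add, eval_mul, eval_C, eval_X]
      rw [mem_uIcc]
      rcases le_total u v with h | h
      · left; constructor <;> nlinarith [hx.1, hx.2]
      · right; constructor <;> nlinarith [hx.1, hx.2])
  rw [derivative_comp, eval_mul, eval_comp] at h
  simp only [eval_add, eval_mul, eval_C, eval_X, derivative_add, derivative_C_mul, derivative_X, derivative_C, eval_zero, eval_one] at h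
  have e : (u-v)/2*1 + (u+v)/2 = u := by ring
  rw [e, mul_one, add_zero, abs_mul, abs_div, abs_two] at h
  have : 0 < |u - v| := abs_pos.mpr (sub_ne_zero.mpr huv)
  rw [le_div_iff₀ this]
  linarith

lemma markov_int (q : ℝ[X]) (n : ℕ) (L : ℝ) (hL0 : 0 < L) (hq : q.natDegree ≤ n) (a b : ℝ)
    (hab : a < b) (hL : ∀ x ∈ Icc a b, |q.eval x| ≤ L) (x : ℝ) (hx : x ∈ Icc a b) :
    |q.derivative.eval x| ≤ 4 * n^2 * L / (b - a) := by
  have hba : 0 < b - a := by linarith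
  obtain ⟨v, hv, hv1, hv2⟩ : ∃ v ∈ Icc a b, x ≠ v ∧ (b-a)/2 ≤ |x - v| := by
    rcases le_total x ((a+b)/2) with h | h
    · refine ⟨b, ⟨hab.le, le_rfl⟩, by linarith |> ne_of_lt, ?_⟩
      rw [abs_sub_comm]; exact le_trans (by linarith) (le_abs_self _)
    · refine ⟨a, ⟨le_rfl, hab.le⟩, by linarith |> ne_of_gt, ?_⟩
      exact le_trans (by linarith) (le_abs_self _)
  refine (markov_seg q n L hL0 hq x v hv1 fun y hy => hL y ?_).trans ?_
  · exact (uIcc_subset_Icc hx hv) hy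
  · have : 0 < |x - v| := abs_pos.mpr (sub_ne_zero.mpr hv1)
    rw [div_le_div_iff₀ this hba]
    have : 0 ≤ (n:ℝ)^2 * L := by positivity
    nlinarith

lemma bernstein_int (q : ℝ[X]) (n : ℕ) (hn : 1 ≤ n) (L : ℝ) (hq : q.natDegree ≤ n) (a b : ℝ)
    (hab : a < b) (hL : ∀ x ∈ Icc a b, |q.eval x| ≤ L) (x : ℝ) (hx : x ∈ Icc a b) :
    √((x-a)*(b-x)) * |q.derivative.eval x| ≤ 9 * n * L := by
  have hba : 0 < b - a := by linarith
  set y := (2*x - a - b)/(b-a) with hy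
  have hyx : (b-a)/2*y + (a+b)/2 = x := by rw [hy]; field_simp; ring
  have h := bernstein_unit (q.comp (C ((b-a)/2) * X + C ((a+b)/2))) n hn L
    (by
      rw [natDegree_comp]
      have : (C ((b-a)/2) * X + C ((a+b)/2) : ℝ[X]).natDegree ≤ 1 := natDegree_linear_le
      nlinarith)
    (by
      intro x hx
      rw [eval_comp]
      apply hL
      simp only [eval_add, eval_mul, eval_C, eval_X]
      constructor <;> nlinarith [hx.1, hx.2]) y
    (by
      rw [hy]
      constructor
      · rw [le_div_iff₀ hba]; linarith [hx.1]
      · rw [div_le_iff₀ hba]; linarith [hx.2])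
  rw [derivative_comp, eval_mul, eval_comp] at h
  simp only [eval_add, eval_mul, eval_C, eval_X, derivative_add, derivative_C_mul, derivative_X, derivative_C, eval_zero, eval_one] at h
  rw [hyx, mul_one, add_zero, abs_mul, abs_of_pos (by positivity : 0 < (b-a)/2), ← mul_assoc] at h
  have e : √((x-a)*(b-x)) = √(1-y^2) * ((b-a)/2) := by
    rw [← Real.sqrt_sq (by positivity : 0 ≤ (b-a)/2), ← Real.sqrt_mul' _ (by positivity)]
    congr 1
    rw [hy]; field_simp; ring
  rw [e]; exact h
end Fuchs

namespace Fuchs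
open Polynomial

lemma E_deriv {A B : ℝ} (hA : 1 < A) (hB : 1 < B) : ∃ K > 0, ∀ (p : ℝ[X]) (n : ℕ) (L : ℝ), 1 ≤ n →
    0 < L → p.natDegree ≤ n → (∀ x ∈ Icc (-A) (-1) ∪ Icc 1 B, |sgn x - p.eval x| ≤ L) →
    ∀ x ∈ Icc (-A) (-1) ∪ Icc 1 B, |p.derivative.eval x| ≤ K * n^2 * L ∧
      |(Rp A B * p.derivative).eval x| ≤ K * n * L := by
  have hA' : 0 < A - 1 := by linarith
  have hB' : 0 < B - 1 := by linarith
  refine ⟨9 * (A+B)^3 + 4/(A-1) + 4/(B-1), by positivity, ?_⟩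
  intro p n L hn hL hp h x hx
  have key : ∀ a b s : ℝ, a < b → (∀ y ∈ Icc a b, |s - p.eval y| ≤ L) → x ∈ Icc a b →
      |p.derivative.eval x| ≤ 4 * n^2 * L / (b - a) ∧
      √((x-a)*(b-x)) * |p.derivative.eval x| ≤ 9 * n * L := by
    intro a b s hab hs hx
    have hd : (p - C s).natDegree ≤ n := by
      rw [natDegree_sub_C]; exact hp
    have hb : ∀ y ∈ Icc a b, |(p - C s).eval y| ≤ L := by
      intro y hy; rw [eval_sub, eval_C, abs_sub_comm]; exact hs y hy
    have h1 := markov_int (p - C s) n L hL hd a b hab hb x hx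
    have h2 := bernstein_int (p - C s) n hn L hd a b hab hb x hx
    simp only [derivative_sub, derivative_C, sub_zero] at h1 h2
    exact ⟨h1, h2⟩
  have fin : ∀ a b : ℝ, a < b → b - a ≤ A + B → 4/(b-a) ≤ 9 * (A+B)^3 + 4/(A-1) + 4/(B-1) →
      x ∈ Icc a b → |(Rp A B).eval x| ≤ (x-a)*(b-x) * (A+B)^2 →
      |p.derivative.eval x| ≤ 4 * n^2 * L / (b - a) ∧
      √((x-a)*(b-x)) * |p.derivative.eval x| ≤ 9 * n * L →
      |p.derivative.eval x| ≤ (9 * (A+B)^3 + 4/(A-1) + 4/(B-1)) * n^2 * L ∧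
      |(Rp A B * p.derivative).eval x| ≤ (9 * (A+B)^3 + 4/(A-1) + 4/(B-1)) * n * L := by
    intro a b hab hba hK hx hR ⟨h1, h2⟩
    constructor
    · refine h1.trans ?_
      have : 4 * n^2 * L / (b - a) = 4/(b-a) * n^2 * L := by ring
      rw [this]; gcongr
    · rw [eval_mul, abs_mul]
      set u := (x-a)*(b-x) with hu
      have hu0 : 0 ≤ u := mul_nonneg (by linarith [hx.1]) (by linarith [hx.2])
      have hsu : √u ≤ A + B := by
        rw [Real.sqrt_le_iff]
        refine ⟨by linarith, ?_⟩
        have : u ≤ (b-a)*(b-a) := by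
          rw [hu]; apply mul_le_mul <;> linarith [hx.1, hx.2]
        nlinarith
      calc |(Rp A B).eval x| * |p.derivative.eval x|
          ≤ (u * (A+B)^2) * |p.derivative.eval x| := by gcongr
        _ = √u * (A+B)^2 * (√u * |p.derivative.eval x|) := by
            nth_rewrite 1 [← Real.mul_self_sqrt hu0]; ring
        _ ≤ (A+B) * (A+B)^2 * (9 * n * L) := by gcongr
        _ = (9 * (A+B)^3 + 0 + 0) * n * L := by ring
        _ ≤ _ := by gcongr <;> positivity
  rcases hx with hx | hx
  · refine fin (-A) (-1) (by linarith) (by linarith) ?_ hx ?_ (key (-A) (-1) (-1) (by linarith) ?_ hx)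
    · have : (-1 - -A) = A - 1 := by ring
      rw [this]
      have : 0 ≤ 9 * (A+B)^3 + 4/(B-1) := by positivity
      linarith
    · rw [Rp_eval]
      have e : (x + A) * (x ^ 2 - 1) * (x - B) = ((x - -A)*(-1-x)) * ((1-x) * (x - B)) := by ring
      rw [e, abs_mul, abs_of_nonneg (mul_nonneg (by linarith [hx.1]) (by linarith [hx.2]) : 0 ≤ (x - -A)*(-1-x))]
      refine mul_le_mul_of_nonneg_left ?_ (mul_nonneg (by linarith [hx.1]) (by linarith [hx.2]))
      rw [abs_le, sq]
      constructor
      · have := mul_le_mul (show (1-x) ≤ A+B by linarith [hx.1]) (show B - x ≤ A+B by linarith [hx.1]) (by linarith [hx.2]) (by linarith)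
        linarith
      · have := mul_nonneg (show 0 ≤ 1-x by linarith [hx.2]) (show 0 ≤ B-x by linarith [hx.2])
        nlinarith
    · intro y hy
      have := h y (Or.inl hy)
      rwa [sgn, if_pos (by linarith [hy.2])] at this
  · refine fin 1 B (by linarith) (by linarith) ?_ hx ?_ (key 1 B 1 (by linarith) ?_ hx)
    · have : 0 ≤ 9 * (A+B)^3 + 4/(A-1) := by positivity
      linarith
    · rw [Rp_eval]
      have e : (x + A) * (x ^ 2 - 1) * (x - B) = ((x - 1)*(B-x)) * (-((x+1) * (x + A))) := by ring
      rw [e, abs_mul, abs_of_nonneg (mul_nonneg (by linarith [hx.1]) (by linarith [hx.2]) : 0 ≤ (x - 1)*(B-x))]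
      refine mul_le_mul_of_nonneg_left ?_ (mul_nonneg (by linarith [hx.1]) (by linarith [hx.2]))
      rw [abs_neg, abs_of_nonneg (mul_nonneg (by linarith [hx.1]) (by linarith [hx.1])), sq]
      exact mul_le_mul (by linarith [hx.2]) (by linarith [hx.2]) (by linarith [hx.1]) (by linarith)
    · intro y hy
      have := h y (Or.inr hy)
      rwa [sgn, if_neg (by linarith [hy.1])] at this

/-- branch of sqrt((z-c)^2-r^2) analytic off [c-r,c+r] -/
noncomputable def sq (c r : ℝ) (z : ℂ) : ℂ := (z - c) * (1 - r^2/(z-c)^2)^(1/2 : ℂ)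

lemma sq_sq (c r : ℝ) (z : ℂ) (hz : z ≠ c) : sq c r z ^ 2 = (z-c)^2 - r^2 := by
  have h0 : z - c ≠ 0 := sub_ne_zero.mpr hz
  unfold sq
  rw [mul_pow, ← Complex.cpow_nat_mul]
  norm_num
  field_simp

lemma sq_slit (c r : ℝ) (hr : 0 < r) (z : ℂ) (hz : ∀ x ∈ Icc (c-r) (c+r), z ≠ ((x:ℝ):ℂ)) :
    z - c ≠ 0 ∧ (1 - r^2/(z-c)^2 : ℂ) ∈ Complex.slitPlane := by
  have h0 : z - c ≠ 0 := sub_ne_zero.mpr (hz c ⟨by linarith, by linarith⟩)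
  refine ⟨h0, ?_⟩
  by_contra hn
  rw [Complex.mem_slitPlane_iff_not_le_zero, not_not] at hn
  obtain ⟨t, ht⟩ : ∃ t : ℝ, (1 - r^2/(z-c)^2 : ℂ) = t := ⟨(1 - r^2/(z-c)^2 : ℂ).re, by
    have := (Complex.le_def.mp hn).2
    apply Complex.ext <;> simp [this] ⟩
  rw [ht] at hn
  have ht0 : t ≤ 0 := by exact_mod_cast hn
  have h1 : (z-c)^2 * (1-t) = (r:ℂ)^2 := by
    rw [← ht]; field_simp; ring
  have h1t : 0 < 1 - t := by linarith
  have h2 : (z - c)^2 = (((r/√(1-t)):ℝ):ℂ)^2 := by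
    have : (1 - t : ℂ) ≠ 0 := by exact_mod_cast h1t.ne'
    rw [← Complex.ofReal_pow, div_pow, Real.sq_sqrt h1t.le]
    push_cast
    rw [eq_div_iff this, h1]
  have h3 : r/√(1-t) ≤ r := by
    apply div_le_self hr.le
    rw [Real.one_le_sqrt]; linarith
  have h4 : 0 ≤ r/√(1-t) := by positivity
  rcases sq_eq_sq_iff_eq_or_eq_neg.mp h2 with h | h
  · exact hz (c + r/√(1-t)) ⟨by linarith, by linarith⟩ (by push_cast at h ⊢; linear_combination h)
  · exact hz (c - r/√(1-t)) ⟨by linarith, by linarith⟩ (by push_cast at h ⊢; linear_combination h)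

lemma sq_diff (c r : ℝ) (hr : 0 < r) (z : ℂ) (hz : ∀ x ∈ Icc (c-r) (c+r), z ≠ ((x:ℝ):ℂ)) :
    DifferentiableAt ℂ (sq c r) z := by
  obtain ⟨h0, h1⟩ := sq_slit c r hr z hz
  unfold sq
  refine (by fun_prop : DifferentiableAt ℂ (fun z : ℂ => z - c) z).mul
    (DifferentiableAt.cpow ?_ (by fun_prop) h1)
  refine (differentiableAt_const _).sub (DifferentiableAt.div (by fun_prop) (by fun_prop) (pow_ne_zero 2 h0))

lemma sq_real (c r x : ℝ) (hx : r^2 ≤ (x-c)^2) :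
    sq c r x = (((x - c) * √(1 - r^2/(x-c)^2) : ℝ) : ℂ) := by
  unfold sq
  have h : 0 ≤ 1 - r^2/(x-c)^2 := by
    rw [sub_nonneg]; exact div_le_one_of_le₀ hx (sq_nonneg _)
  rw [Real.sqrt_eq_rpow]
  push_cast
  rw [Complex.ofReal_cpow h]
  push_cast
  rfl

lemma sq_tendsto (c r : ℝ) : Tendsto (fun z : ℂ => sq c r z / z) (Bornology.cobounded ℂ) (nhds 1) := by
  have hsub : Tendsto (fun z : ℂ => z - c) (Bornology.cobounded ℂ) (Bornology.cobounded ℂ) := by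
    rw [← tendsto_norm_atTop_iff_cobounded]
    have := tendsto_norm_cobounded_atTop (E := ℂ)
    refine tendsto_atTop_mono (f := fun z : ℂ => ‖z‖ - ‖(c:ℂ)‖) (fun z => norm_sub_norm_le _ _) ?_
    exact tendsto_atTop_add_const_right _ _ this
  have hinv : Tendsto (fun z : ℂ => (z - c)⁻¹) (Bornology.cobounded ℂ) (nhds 0) :=
    (tendsto_inv₀_cobounded (α := ℂ)).comp hsub
  have hinv' : Tendsto (fun z : ℂ => z⁻¹) (Bornology.cobounded ℂ) (nhds 0) := tendsto_inv₀_cobounded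
  have h1 : Tendsto (fun z : ℂ => (1 - (r:ℂ)^2 * ((z-c)⁻¹)^2)^(1/2:ℂ)) (Bornology.cobounded ℂ) (nhds 1) := by
    have : Tendsto (fun z : ℂ => (1 - (r:ℂ)^2 * ((z-c)⁻¹)^2)) (Bornology.cobounded ℂ) (nhds (1 - (r:ℂ)^2 * 0^2)) :=
      tendsto_const_nhds.sub ((hinv.pow 2).const_mul _)
    have h2 := this.cpow (tendsto_const_nhds (x := (1/2:ℂ))) (by simp)
    simpa using h2
  have h2 : Tendsto (fun z : ℂ => (1 - c * z⁻¹)) (Bornology.cobounded ℂ) (nhds (1 - c * 0)) :=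
    tendsto_const_nhds.sub (hinv'.const_mul _)
  have h3 := h2.mul h1
  simp only [mul_zero, sub_zero, mul_one] at h3
  refine h3.congr' ?_
  have : ∀ᶠ z : ℂ in Bornology.cobounded ℂ, z ≠ 0 := by
    exact Bornology.eventually_ne_cobounded 0
  filter_upwards [this] with z hz
  unfold sq
  rw [inv_pow, ← div_eq_mul_inv]
  field_simp

lemma poly_tendsto (P : ℂ[X]) (m : ℕ) (hP : P.natDegree ≤ m) :
    Tendsto (fun z : ℂ => P.eval z / z^m) (Bornology.cobounded ℂ) (nhds (P.coeff m)) := by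
  have hinv' : Tendsto (fun z : ℂ => z⁻¹) (Bornology.cobounded ℂ) (nhds 0) := tendsto_inv₀_cobounded
  have h : Tendsto (fun z : ℂ => ∑ k ∈ Finset.range (m+1), P.coeff k * (z⁻¹)^(m-k)) (Bornology.cobounded ℂ)
      (nhds (∑ k ∈ Finset.range (m+1), P.coeff k * 0^(m-k))) :=
    tendsto_finsetSum _ fun k _ => (hinv'.pow _).const_mul _
  have e : ∑ k ∈ Finset.range (m+1), P.coeff k * (0:ℂ)^(m-k) = P.coeff m := by
    rw [Finset.sum_range_succ, Finset.sum_eq_zero]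
    · simp
    · intro k hk
      have : m - k ≠ 0 := by have := Finset.mem_range.mp hk; omega
      simp [this]
  rw [e] at h
  refine h.congr' ?_
  filter_upwards [Bornology.eventually_ne_cobounded (0:ℂ)] with z hz
  rw [Polynomial.eval_eq_sum_range' (n := m+1) (by omega), Finset.sum_div]
  refine Finset.sum_congr rfl fun k hk => ?_
  have hk' : k ≤ m := by simp at hk; omega
  obtain ⟨j, rfl⟩ := Nat.exists_eq_add_of_le hk'
  rw [add_tsub_cancel_left, pow_add, inv_pow]
  field_simp
end Fuchs

namespace Fuchs
open Polynomial

noncomputable def ss (A B : ℝ) (z : ℂ) : ℂ := sq (-(A+1)/2) ((A-1)/2) z * sq ((B+1)/2) ((B-1)/2) z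

lemma ss_sq {A B : ℝ} (hA : 1 < A) (hB : 1 < B) (z : ℂ)
    (hz : ∀ x ∈ Icc (-A) (-1) ∪ Icc 1 B, z ≠ ((x:ℝ):ℂ)) :
    ss A B z ^ 2 = ((Rp A B).map (algebraMap ℝ ℂ)).eval z := by
  unfold ss
  rw [mul_pow, sq_sq _ _ _ (hz _ (Or.inl ⟨by linarith, by linarith⟩)),
    sq_sq _ _ _ (hz _ (Or.inr ⟨by linarith, by linarith⟩))]
  simp [Rp]
  ring

lemma ss_diff {A B : ℝ} (hA : 1 < A) (hB : 1 < B) (z : ℂ)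
    (hz : ∀ x ∈ Icc (-A) (-1) ∪ Icc 1 B, z ≠ ((x:ℝ):ℂ)) : DifferentiableAt ℂ (ss A B) z := by
  unfold ss
  refine (sq_diff _ _ (by linarith) z ?_).mul (sq_diff _ _ (by linarith) z ?_)
  · intro x hx; exact hz x (Or.inl ⟨by linarith [hx.1], by linarith [hx.2]⟩)
  · intro x hx; exact hz x (Or.inr ⟨by linarith [hx.1], by linarith [hx.2]⟩)

lemma ss_real {A B : ℝ} (hA : 1 < A) (hB : 1 < B) (x : ℝ) (hx : x ∈ Ioo (-1:ℝ) 1) :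
    ss A B x = ((-√((Rp A B).eval x) : ℝ) : ℂ) := by
  have h1 : ((A-1)/2)^2 ≤ (x - (-(A+1)/2))^2 := by nlinarith [hx.1]
  have h2 : ((B-1)/2)^2 ≤ (x - (B+1)/2)^2 := by nlinarith [hx.2]
  have hR := Rp_pos hA hB hx
  have hs := ss_sq hA hB x (by
    rintro y (hy | hy) hxy
    · have : x = y := by exact_mod_cast hxy
      linarith [hy.2, hx.1]
    · have : x = y := by exact_mod_cast hxy
      linarith [hy.1, hx.2])
  rw [map_eval_real] at hs
  unfold ss at hs ⊢
  rw [sq_real _ _ _ h1, sq_real _ _ _ h2, ← Complex.ofReal_mul] at hs ⊢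
  have hs' : ((x - -(A + 1) / 2) * √(1 - ((A - 1) / 2) ^ 2 / (x - -(A + 1) / 2) ^ 2) *
        ((x - (B + 1) / 2) * √(1 - ((B - 1) / 2) ^ 2 / (x - (B + 1) / 2) ^ 2)))^2 = (Rp A B).eval x := by
    exact_mod_cast hs
  congr 1
  set t := ((x - -(A + 1) / 2) * √(1 - ((A - 1) / 2) ^ 2 / (x - -(A + 1) / 2) ^ 2) *
        ((x - (B + 1) / 2) * √(1 - ((B - 1) / 2) ^ 2 / (x - (B + 1) / 2) ^ 2))) with ht
  have ht0 : t ≤ 0 := by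
    rw [ht]
    apply mul_nonpos_of_nonneg_of_nonpos
    · exact mul_nonneg (by linarith [hx.1]) (Real.sqrt_nonneg _)
    · exact mul_nonpos_of_nonpos_of_nonneg (by linarith [hx.2]) (Real.sqrt_nonneg _)
  rw [← hs', Real.sqrt_sq_eq_abs, abs_of_nonpos ht0, neg_neg]

lemma ss_tendsto (A B : ℝ) :
    Tendsto (fun z : ℂ => ss A B z / z^2) (Bornology.cobounded ℂ) (nhds 1) := by
  have := (sq_tendsto (-(A+1)/2) ((A-1)/2)).mul (sq_tendsto ((B+1)/2) ((B-1)/2))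
  rw [mul_one] at this
  refine this.congr fun z => ?_
  unfold ss
  rw [div_mul_div_comm, pow_two]

lemma pell_cx {A B : ℝ} {P Q : ℝ[X]} {α : ℝ} {m : ℕ} (h : Pell A B P Q α m) (z : ℂ) :
    (P.map (algebraMap ℝ ℂ)).eval z ^ 2 - ((Rp A B).map (algebraMap ℝ ℂ)).eval z *
      (Q.map (algebraMap ℝ ℂ)).eval z ^ 2 = 1 + α * z := by
  have := congrArg (fun p : ℝ[X] => (p.map (algebraMap ℝ ℂ)).eval z) h.eq
  simp only [Polynomial.map_sub, Polynomial.map_pow, Polynomial.map_mul, Polynomial.map_add,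
    eval_sub, eval_pow, eval_mul, eval_add, map_C, map_X, eval_C, eval_X] at this
  simp only [Complex.coe_algebraMap, Complex.ofReal_one] at this
  rw [this]; ring

lemma inf_tendsto {A B : ℝ} (hA : 1 < A) (hB : 1 < B) {P Q S : ℝ[X]} {α : ℝ} {m : ℕ}
    (h : Pell A B P Q α m) (hS : S.natDegree + 2 ≤ m) :
    Tendsto (fun z : ℂ => (S.map (algebraMap ℝ ℂ)).eval z * ((P.map (algebraMap ℝ ℂ)).eval z -
      (Q.map (algebraMap ℝ ℂ)).eval z * ss A B z)) (Bornology.cobounded ℂ) (nhds 0) := by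
  obtain ⟨k, rfl⟩ : ∃ k, m = k + 2 := ⟨m - 2, by omega⟩
  have hinv : Tendsto (fun z : ℂ => z⁻¹) (Bornology.cobounded ℂ) (nhds 0) := tendsto_inv₀_cobounded
  have hP := poly_tendsto (P.map (algebraMap ℝ ℂ)) (k+2) (by rw [natDegree_map, h.hP])
  have hQn : Q.natDegree = k := by have := h.hQ; omega
  have hQ := poly_tendsto (Q.map (algebraMap ℝ ℂ)) k (by rw [natDegree_map, hQn])
  have hSt := poly_tendsto (S.map (algebraMap ℝ ℂ)) k (by rw [natDegree_map]; omega)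
  have hc : (Q.map (algebraMap ℝ ℂ)).coeff k = ((P.leadingCoeff : ℝ) : ℂ) := by
    rw [coeff_map, ← h.hl, leadingCoeff, hQn]; rfl
  have hc' : (P.map (algebraMap ℝ ℂ)).coeff (k+2) = ((P.leadingCoeff : ℝ) : ℂ) := by
    rw [coeff_map, leadingCoeff, h.hP]; rfl
  have hl0 : P.leadingCoeff ≠ 0 := by
    rw [Ne, leadingCoeff_eq_zero]
    intro h0; have := h.hP; rw [h0] at this; simp at this
  rw [hc] at hQ
  rw [hc'] at hP
  have hD := hP.add (hQ.mul (ss_tendsto A B))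
  have hD0 : ((P.leadingCoeff : ℝ) : ℂ) + ((P.leadingCoeff : ℝ) : ℂ) * 1 ≠ 0 := by
    rw [mul_one, ← two_mul]
    exact mul_ne_zero two_ne_zero (by exact_mod_cast hl0)
  have hN : Tendsto (fun z : ℂ => (S.map (algebraMap ℝ ℂ)).eval z / z^k * (z⁻¹ * z⁻¹ + α * z⁻¹))
      (Bornology.cobounded ℂ) (nhds ((S.map (algebraMap ℝ ℂ)).coeff k * (0 * 0 + α * 0))) :=
    hSt.mul ((hinv.mul hinv).add (hinv.const_mul _))
  have hfin := hN.div hD hD0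
  simp only [mul_zero, add_zero, zero_div] at hfin
  refine hfin.congr' ?_
  have hb : ∀ᶠ z : ℂ in Bornology.cobounded ℂ, A + B < ‖z‖ :=
    (tendsto_norm_cobounded_atTop (E := ℂ)).eventually_gt_atTop (A+B)
  filter_upwards [hb, hD.eventually_ne hD0] with z hz hDz
  have hz0 : z ≠ 0 := by rintro rfl; simp at hz; linarith
  have hE : ∀ x ∈ Icc (-A) (-1) ∪ Icc 1 B, z ≠ ((x:ℝ):ℂ) := by
    rintro x hx rfl
    rw [Complex.norm_real, Real.norm_eq_abs] at hz
    have : |x| ≤ A + B := by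
      rw [abs_le]
      rcases hx with hx | hx <;> constructor <;> linarith [hx.1, hx.2]
    linarith
  have hs := ss_sq hA hB z hE
  have hp := pell_cx h z
  simp only [Pi.div_apply]
  rw [div_eq_iff hDz]
  set p := (P.map (algebraMap ℝ ℂ)).eval z
  set q := (Q.map (algebraMap ℝ ℂ)).eval z
  set S' := (S.map (algebraMap ℝ ℂ)).eval z
  rw [← hs] at hp
  have e : p / z^(k+2) + q / z^k * (ss A B z / z^2) = (p + q * ss A B z) / z^(k+2) := by
    rw [div_mul_div_comm, ← pow_add, ← add_div]
  have e2 : S' / z^k * (z⁻¹ * z⁻¹ + α * z⁻¹) = S' * (1 + α * z) / z^(k+2) := by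
    rw [pow_add]; field_simp
  rw [e, e2, ← hp]
  ring

lemma bw {A B : ℝ} (hA : 1 < A) (hB : 1 < B) {P Q S : ℝ[X]} {α : ℝ} {m : ℕ}
    (h : Pell A B P Q α m) (hS : S.natDegree + 2 ≤ m) {M : ℝ} (hM : 0 < M)
    (hSM : ∀ x ∈ Icc (-A) (-1) ∪ Icc 1 B, |S.eval x| ≤ M) (x : ℝ) (hx : x ∈ Ioo (-1:ℝ) 1) :
    |S.eval x| * |FF A B P Q x| ≤ √(2*(2+A+B)) * M := by
  set c := 2*(2+A+B) with hc
  have hc0 : 0 < c := by rw [hc]; linarith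
  have hK : 0 < √c * M := by positivity
  let p : ℂ → ℂ := fun z => (P.map (algebraMap ℝ ℂ)).eval z
  let q : ℂ → ℂ := fun z => (Q.map (algebraMap ℝ ℂ)).eval z
  let s : ℂ → ℂ := fun z => (S.map (algebraMap ℝ ℂ)).eval z
  let R : ℂ → ℂ := fun z => ((Rp A B).map (algebraMap ℝ ℂ)).eval z
  let f : ℂ → ℂ := fun z => s z * (p z - q z * ss A B z)
  let H : ℂ → ℝ := fun z => 2 * ‖s z‖^2 * (‖p z‖^2 + ‖q z‖^2 * ‖R z‖)
  have hHc : Continuous H := by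
    have := (P.map (algebraMap ℝ ℂ)).continuous
    have := (Q.map (algebraMap ℝ ℂ)).continuous
    have := (S.map (algebraMap ℝ ℂ)).continuous
    have := ((Rp A B).map (algebraMap ℝ ℂ)).continuous
    fun_prop
  have hHE : ∀ x ∈ Icc (-A) (-1) ∪ Icc 1 B, H ((x:ℝ):ℂ) < c * M^2 := by
    intro x hx
    have e : H ((x:ℝ):ℂ) = 2 * |S.eval x|^2 * (1 + α * x) := by
      simp only [H, s, p, q, R, map_eval_real, Complex.norm_real, Real.norm_eq_abs]
      rw [abs_of_nonpos (Rp_nonpos hA hB hx), ← h.eval_eq x, sq_abs, sq_abs, sq_abs]; ring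
    rw [e]
    have h1 := ell_le_E hA hB h.h1 h.h2 hx
    have h2 : |S.eval x|^2 ≤ M^2 := by gcongr; exact hSM x hx
    have h3 : 0 ≤ |S.eval x|^2 := by positivity
    have h4 : 0 < M^2 := by positivity
    calc 2 * |S.eval x|^2 * (1 + α * x) ≤ 2 * |S.eval x|^2 * (1 + A + B) := by gcongr
      _ ≤ 2 * M^2 * (1 + A + B) := by
        have : 0 ≤ 1 + A + B := by linarith
        gcongr
      _ < c * M^2 := by rw [hc]; nlinarith
  have hfH : ∀ z : ℂ, (∀ x ∈ Icc (-A) (-1) ∪ Icc 1 B, z ≠ ((x:ℝ):ℂ)) → ‖f z‖^2 ≤ H z := by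
    intro z hz
    have h1 : ‖ss A B z‖^2 = ‖R z‖ := by rw [← norm_pow, ss_sq hA hB z hz]
    have h2 := norm_sub_le (p z) (q z * ss A B z)
    rw [norm_mul] at h2
    have h3 : ‖p z - q z * ss A B z‖^2 ≤ 2 * (‖p z‖^2 + ‖q z‖^2 * ‖R z‖) := by
      rw [← h1]
      have : ‖p z - q z * ss A B z‖^2 ≤ (‖p z‖ + ‖q z‖ * ‖ss A B z‖)^2 := by gcongr
      nlinarith [sq_nonneg (‖p z‖ - ‖q z‖ * ‖ss A B z‖)]
    simp only [f, H, norm_mul, mul_pow]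
    have : 0 ≤ ‖s z‖^2 := by positivity
    nlinarith
  have hinf := inf_tendsto hA hB h hS
  have hev : ∀ᶠ z : ℂ in Bornology.cobounded ℂ, ‖f z‖ ≤ √c * M := by
    have := hinf.norm
    rw [norm_zero] at this
    exact (this.eventually_lt_const hK).mono fun z hz => hz.le
  obtain ⟨r, hr⟩ := (Metric.hasBasis_cobounded_compl_closedBall (0:ℂ)).eventually_iff.mp hev
  obtain ⟨_, hr⟩ := hr
  set ρ := max (r+1) 2 with hρ
  have hout : ∀ z : ℂ, ‖z‖ = ρ → ‖f z‖ ≤ √c * M := by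
    intro z hz
    apply hr
    simp only [mem_compl_iff, Metric.mem_closedBall, dist_zero_right, not_le]
    rw [hz]; exact lt_of_lt_of_le (by linarith) (le_max_left _ _)
  let U : Set ℂ := Metric.ball 0 ρ ∩ {z | c * M^2 < H z}
  have hUo : IsOpen U := Metric.isOpen_ball.inter (isOpen_lt continuous_const hHc)
  have hcl : closure U ⊆ Metric.closedBall 0 ρ ∩ {z | c * M^2 ≤ H z} := by
    apply closure_minimal
    · intro z hz
      exact ⟨Metric.ball_subset_closedBall hz.1, by have := hz.2; simp only [Set.mem_ofPred_eq] at this ⊢; exact this.le⟩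
    · exact Metric.isClosed_closedBall.inter (isClosed_le continuous_const hHc)
  have hnE : ∀ z ∈ closure U, ∀ x ∈ Icc (-A) (-1) ∪ Icc 1 B, z ≠ ((x:ℝ):ℂ) := by
    rintro z hz x hx rfl
    have := (hcl hz).2
    have h2 := hHE x hx
    simp only [Set.mem_ofPred_eq] at this
    linarith
  have hsm : ∀ z : ℂ, ‖f z‖^2 ≤ c * M^2 → ‖f z‖ ≤ √c * M := by
    intro z hz
    apply (pow_le_pow_iff_left₀ (norm_nonneg _) hK.le two_ne_zero).mp
    rw [mul_pow, Real.sq_sqrt hc0.le]; exact hz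
  have hxE : ∀ y ∈ Icc (-A) (-1) ∪ Icc 1 B, (x:ℂ) ≠ ((y:ℝ):ℂ) := by
    rintro y (hy | hy) hxy
    · have : x = y := by exact_mod_cast hxy
      linarith [hy.2, hx.1]
    · have : x = y := by exact_mod_cast hxy
      linarith [hy.1, hx.2]
  have main : ‖f x‖ ≤ √c * M := by
    by_cases hxU : (x:ℂ) ∈ U
    · refine Complex.norm_le_of_forall_mem_frontier_norm_le (U := U)
        (Metric.isBounded_ball.subset inter_subset_left) ?_ ?_ (subset_closure hxU)
      · apply DifferentiableOn.diffContOnCl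
        intro z hz
        apply DifferentiableAt.differentiableWithinAt
        have := ss_diff hA hB z (hnE z hz)
        have h1 : DifferentiableAt ℂ s z := (S.map (algebraMap ℝ ℂ)).differentiableAt
        have h2 : DifferentiableAt ℂ p z := (P.map (algebraMap ℝ ℂ)).differentiableAt
        have h3 : DifferentiableAt ℂ q z := (Q.map (algebraMap ℝ ℂ)).differentiableAt
        exact h1.mul (h2.sub (h3.mul this))
      · intro z hz
        rw [hUo.frontier_eq] at hz
        have hz1 := hcl hz.1
        by_cases hzr : ‖z‖ = ρ
        · exact hout z hzr
        · have hlt : ‖z‖ < ρ := lt_of_le_of_ne (by simpa using hz1.1) hzr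
          have : ¬ c * M^2 < H z := fun hh => hz.2 ⟨by simpa using hlt, hh⟩
          exact hsm z ((hfH z (hnE z hz.1)).trans (not_lt.mp this))
    · have hxr : (x:ℂ) ∈ Metric.ball (0:ℂ) ρ := by
        simp only [Metric.mem_ball, dist_zero_right, Complex.norm_real, Real.norm_eq_abs]
        have : |x| < 1 := abs_lt.mpr hx
        exact lt_of_lt_of_le (by linarith) (le_max_right _ _)
      have : ¬ c * M^2 < H x := fun hh => hxU ⟨hxr, hh⟩
      exact hsm x ((hfH x hxE).trans (not_lt.mp this))
  have e : f x = ((S.eval x * FF A B P Q x : ℝ) : ℂ) := by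
    simp only [f, s, p, q, map_eval_real]
    rw [ss_real hA hB x hx, FF]; push_cast; ring
  rw [e, Complex.norm_real, Real.norm_eq_abs, abs_mul] at main
  exact main
end Fuchs

namespace Fuchs
open Polynomial

lemma gap_one {A B : ℝ} (hA : 1 < A) (hB : 1 < B) : ∃ K > 0, ∃ c > 0, ∀ (S : ℝ[X]) (n : ℕ) (M : ℝ),
    0 < M → S.natDegree ≤ n + 3 → (∀ x ∈ Icc (-A) (-1) ∪ Icc 1 B, |S.eval x| ≤ M) →
    ∀ x ∈ Ioo (-1:ℝ) 1, |S.eval x| ≤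
      K * M * (Real.exp (n * eta A B) * Real.exp (- (n * c) * (x - Ccrit A B)^2)) := by
  obtain ⟨KK, hKK⟩ := KP hA hB
  obtain ⟨c, hc, hG⟩ := Gg_le hA hB
  have hη := eta_nonneg hA hB
  refine ⟨√(2*(2+A+B)) * Real.exp (KK + 6 * eta A B), by
    have : 0 < 2*(2+A+B) := by linarith
    positivity, c, hc, ?_⟩
  intro S n M hM hS hSM x hx
  obtain ⟨P, Q, α, m, hm1, hm2, hP⟩ := Pell.exists hA hB (n+6) (by omega)
  have hb := bw hA hB hP (by omega) hM hSM x hx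
  have hx' : x ∈ Icc (-1:ℝ) 1 := ⟨hx.1.le, hx.2.le⟩
  have hk := hKK P Q α m hP x hx'
  have hF := FF_ne hA hB hP hx'
  have hFp : 0 < |FF A B P Q x| := abs_pos.mpr hF
  have hg := hG x hx'
  set t := (x - Ccrit A B)^2
  have ht : 0 ≤ t := sq_nonneg _
  have hlow : Real.exp (-(KK + 6 * eta A B) - (n * eta A B - n * c * t)) ≤ |FF A B P Q x| := by
    rw [← Real.exp_log hFp, Real.log_abs]
    apply Real.exp_le_exp.mpr
    have h1 := (abs_le.mp hk).1
    have h2 : (m:ℝ) * Gg A B x ≤ n * (eta A B - c * t) + 6 * eta A B := by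
      have hmn : (n:ℝ) ≤ m := by exact_mod_cast (by omega : n ≤ m)
      have hmn' : (m:ℝ) ≤ n + 6 := by exact_mod_cast hm2
      have hge : Gg A B x ≤ eta A B := by nlinarith
      have a1 : (n:ℝ) * Gg A B x ≤ n * (eta A B - c * t) := by gcongr
      have a2 : ((m:ℝ) - n) * Gg A B x ≤ ((m:ℝ) - n) * eta A B := by
        apply mul_le_mul_of_nonneg_left hge; linarith
      have a3 : ((m:ℝ) - n) * eta A B ≤ 6 * eta A B := by
        apply mul_le_mul_of_nonneg_right _ hη; linarith
      nlinarith
    nlinarith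
  have hpos : 0 ≤ |S.eval x| := abs_nonneg _
  have h3 : |S.eval x| * Real.exp (-(KK + 6 * eta A B) - (n * eta A B - n * c * t)) ≤ √(2*(2+A+B)) * M :=
    (mul_le_mul_of_nonneg_left hlow hpos).trans hb
  rw [← le_div_iff₀ (Real.exp_pos _)] at h3
  refine h3.trans (le_of_eq ?_)
  rw [div_eq_mul_inv, ← Real.exp_neg, ← Real.exp_add]
  have : -(-(KK + 6 * eta A B) - (n * eta A B - n * c * t)) = (KK + 6 * eta A B) + (n * eta A B + -(n*c) * t) := by ring
  rw [this, Real.exp_add]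
  ring

lemma gap_two {A B : ℝ} (hA : 1 < A) (hB : 1 < B) : ∃ K > 0, ∃ c > 0, ∀ (p : ℝ[X]) (n : ℕ) (L : ℝ),
    1 ≤ n → 0 < L → p.natDegree ≤ n → (∀ x ∈ Icc (-A) (-1) ∪ Icc 1 B, |sgn x - p.eval x| ≤ L) →
    ∀ x ∈ Ioo (-1:ℝ) 1, |p.derivative.eval x| ≤
      K * n * L * Real.exp (n * eta A B) * Real.exp (- (n * c) * (x - Ccrit A B)^2) := by
  obtain ⟨K1, hK1, hE⟩ := E_deriv hA hB
  obtain ⟨K2, hK2, c, hc, hg⟩ := gap_one hA hB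
  obtain ⟨hC1, hC2⟩ := Ccrit_mem hA hB
  set C0 := Ccrit A B
  obtain ⟨δ, hδ, hδ1, hδ2⟩ : ∃ δ > 0, 2 * δ ≤ 1 - C0 ∧ 2 * δ ≤ 1 + C0 :=
    ⟨min ((1 - C0)/2) ((1+C0)/2), lt_min (by linarith) (by linarith),
      by linarith [min_le_left ((1 - C0)/2) ((1+C0)/2)], by linarith [min_le_right ((1 - C0)/2) ((1+C0)/2)]⟩
  refine ⟨K1 * K2 * (1/δ^4 + 2/(c*δ^2)), by positivity, c/2, by positivity, ?_⟩
  intro p n L hn hL hp h x hx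
  have hn0 : (0:ℝ) < n := by exact_mod_cast hn
  have hd := hE p n L hn hL hp h
  have hpd : p.derivative.natDegree ≤ n - 1 := (natDegree_derivative_le p).trans (by omega)
  have hexp : Real.exp (- (n * c) * (x - C0)^2) ≤ Real.exp (- (n * (c/2)) * (x - C0)^2) := by
    apply Real.exp_le_exp.mpr
    have : 0 ≤ n * c * (x-C0)^2 := by positivity
    nlinarith
  by_cases hxd : |x - C0| ≤ δ
  · have h1 := hg (Rp A B * p.derivative) n (K1 * n * L) (by positivity)
      (natDegree_mul_le.trans (by rw [Rp_natDegree]; omega)) (fun y hy => (hd y hy).2) x hx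
    rw [eval_mul, abs_mul] at h1
    rw [abs_le] at hxd
    have hR : δ^4 ≤ |(Rp A B).eval x| := by
      refine le_trans ?_ (le_abs_self _)
      rw [Rp_eval]
      have e : (x + A) * (x ^ 2 - 1) * (x - B) = (x + A) * (1+x) * ((1-x) * (B - x)) := by ring
      have e2 : δ^4 = δ * δ * (δ * δ) := by ring
      rw [e, e2]
      have b1 : δ ≤ x + A := by linarith
      have b2 : δ ≤ 1 + x := by linarith
      have b3 : δ ≤ 1 - x := by linarith
      have b4 : δ ≤ B - x := by linarith
      have : 0 ≤ 1 - x := by linarith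
      have : 0 ≤ x + A := by linarith
      have : 0 ≤ 1 + x := by linarith
      gcongr
    have h2 : δ^4 * |p.derivative.eval x| ≤ K2 * (K1 * n * L) * (Real.exp (n * eta A B) * Real.exp (- (n * c) * (x - C0)^2)) :=
      (mul_le_mul_of_nonneg_right hR (abs_nonneg _)).trans h1
    rw [← le_div_iff₀' (by positivity)] at h2
    calc |p.derivative.eval x| ≤ _ := h2
      _ = K1 * K2 * (1/δ^4) * n * L * Real.exp (n * eta A B) * Real.exp (- (n * c) * (x - C0)^2) := by
          field_simp
      _ ≤ _ := by
          gcongr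
          have : 0 ≤ 2/(c*δ^2) := by positivity
          linarith
  · push Not at hxd
    have h1 := hg p.derivative n (K1 * n^2 * L) (by positivity)
      (by omega) (fun y hy => (hd y hy).1) x hx
    have h2 : n * Real.exp (- (n * c) * (x - C0)^2) ≤ 2/(c*δ^2) * Real.exp (- (n * (c/2)) * (x - C0)^2) := by
      have e : - (n * c) * (x - C0)^2 = -(n * (c/2) * (x-C0)^2) + - (n * (c/2)) * (x - C0)^2 := by ring
      rw [e, Real.exp_add, ← mul_assoc]
      gcongr
      have hs : δ^2 ≤ (x-C0)^2 := by rw [← sq_abs (x - C0)]; gcongr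
      have h3 : n * (c/2) * δ^2 ≤ n * (c/2) * (x-C0)^2 := by gcongr
      have h4 := Real.add_one_le_exp (n * (c/2) * (x-C0)^2)
      rw [Real.exp_neg, ← div_eq_mul_inv, div_le_iff₀ (Real.exp_pos _), div_mul_eq_mul_div,
        le_div_iff₀ (by positivity)]
      nlinarith
    calc |p.derivative.eval x| ≤ _ := h1
      _ = K1 * K2 * n * L * Real.exp (n * eta A B) * (n * Real.exp (- (n * c) * (x - C0)^2)) := by ring
      _ ≤ K1 * K2 * n * L * Real.exp (n * eta A B) * (2/(c*δ^2) * Real.exp (- (n * (c/2)) * (x - C0)^2)) := by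
          gcongr
      _ = K1 * K2 * (2/(c*δ^2)) * n * L * Real.exp (n * eta A B) * Real.exp (- (n * (c/2)) * (x - C0)^2) := by ring
      _ ≤ _ := by
          gcongr
          have : 0 ≤ 1/δ^4 := by positivity
          linarith

lemma lower_aux {A B : ℝ} (hA : 1 < A) (hB : 1 < B) : ∃ C₁ > 0, ∀ (p : ℝ[X]) (n : ℕ) (L : ℝ),
    1 ≤ n → 0 < L → p.natDegree ≤ n → (∀ x ∈ Icc (-A) (-1) ∪ Icc 1 B, |sgn x - p.eval x| ≤ L) →
    C₁ * (n:ℝ)^(-(1:ℝ)/2) * Real.exp (-(eta A B)*n) ≤ L := by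
  obtain ⟨K, hK, c, hc, hg⟩ := gap_two hA hB
  have hη := eta_nonneg hA hB
  have hpi := Real.pi_pos
  refine ⟨min (1/2) (1/(K * √(π/c))), by positivity, ?_⟩
  intro p n L hn hL hp h
  have hn0 : (0:ℝ) < n := by exact_mod_cast hn
  rw [rpow_half]
  rcases le_or_gt (1/2) L with hL2 | hL2
  · have h1 : 1/√(n:ℝ) ≤ 1 := by
      apply div_le_one_of_le₀ _ (Real.sqrt_nonneg _)
      rw [Real.one_le_sqrt]; exact_mod_cast hn
    have h2 : Real.exp (-(eta A B)*n) ≤ 1 := by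
      rw [Real.exp_le_one_iff]; nlinarith [mul_nonneg hη hn0.le]
    calc _ ≤ (1/2) * 1 * 1 := by
          gcongr
          exact min_le_left _ _
      _ ≤ L := by linarith
  · have e1 := h 1 (Or.inr ⟨le_rfl, hB.le⟩)
    have e2 := h (-1) (Or.inl ⟨by linarith, le_rfl⟩)
    rw [sgn, if_neg (by norm_num)] at e1
    rw [sgn, if_pos (by norm_num)] at e2
    have e3 := (abs_le.mp e1).2
    have e4 := (abs_le.mp e2).1
    have hIntegr : ∫ x in (-1:ℝ)..1, p.derivative.eval x = p.eval 1 - p.eval (-1) := by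
      apply intervalIntegral.integral_eq_sub_of_hasDerivAt (f := fun x => p.eval x)
      · intro x _; exact p.hasDerivAt x
      · exact (p.derivative.continuous).intervalIntegrable _ _
    set D := K * n * L * Real.exp (n * eta A B) with hD
    have hb : 0 < n * c := by positivity
    have hgi : Integrable (fun x : ℝ => Real.exp (-(n*c) * (x - Ccrit A B)^2)) :=
      (integrable_exp_neg_mul_sq hb).comp_sub_right (Ccrit A B)
    have hle := intervalIntegral.norm_integral_le_of_norm_le (μ := volume) (f := fun x => p.derivative.eval x)
      (g := fun x => D * Real.exp (-(n*c) * (x - Ccrit A B)^2)) (by norm_num : (-1:ℝ) ≤ 1)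
      (by
        have : ∀ᵐ t : ℝ, t ≠ 1 := by simp [ae_iff]
        filter_upwards [this] with t ht1 ht
        exact hg p n L hn hL hp h t ⟨ht.1, lt_of_le_of_ne ht.2 ht1⟩)
      (hgi.const_mul D).intervalIntegrable
    have hI : ∫ x in (-1:ℝ)..1, D * Real.exp (-(n*c) * (x - Ccrit A B)^2) ≤ D * √(π/(n*c)) := by
      rw [intervalIntegral.integral_const_mul]
      apply mul_le_mul_of_nonneg_left _ (by positivity)
      rw [intervalIntegral.integral_of_le (by norm_num)]
      refine (setIntegral_le_integral hgi (ae_of_all _ fun x => (Real.exp_pos _).le)).trans ?_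
      rw [integral_sub_right_eq_self (fun x => Real.exp (-(n*c) * x^2)) (Ccrit A B), integral_gaussian]
    rw [hIntegr] at hle
    have h1 : 1 ≤ D * √(π/(n*c)) := by
      have := le_trans (le_abs_self _) hle
      linarith
    have hs : √(π/(n*c)) = √(π/c) / √n := by
      rw [← Real.sqrt_div (by positivity)]; congr 1; field_simp
    have hsn : 0 < √(n:ℝ) := Real.sqrt_pos.mpr hn0
    have hnn : (n:ℝ) = √n * √n := (Real.mul_self_sqrt hn0.le).symm
    have h2 : D * √(π/(n*c)) = (K * √(π/c)) * √n * Real.exp (n * eta A B) * L := by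
      rw [hs, hD, mul_div_assoc', div_eq_iff hsn.ne']
      calc K * n * L * Real.exp (n * eta A B) * √(π/c)
          = K * L * Real.exp (n * eta A B) * √(π/c) * n := by ring
        _ = K * L * Real.exp (n * eta A B) * √(π/c) * (√n * √n) := by rw [← hnn]
        _ = _ := by ring
    rw [h2] at h1
    have hpos : 0 < K * √(π/c) := by positivity
    calc _ ≤ 1/(K * √(π/c)) * (1/√n) * Real.exp (-(eta A B)*n) := by
          gcongr
          exact min_le_right _ _
      _ ≤ 1/(K * √(π/c)) * (1/√n) * Real.exp (-(eta A B)*n) * ((K * √(π/c)) * √n * Real.exp (n * eta A B) * L) :=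
          le_mul_of_one_le_right (by positivity) h1
      _ = L * (Real.exp (-(eta A B)*n) * Real.exp (n * eta A B)) := by field_simp
      _ = L := by
          rw [← Real.exp_add]
          have : -(eta A B)*n + n * eta A B = 0 := by ring
          rw [this, Real.exp_zero, mul_one]

lemma sgn_bdd (A B : ℝ) (p : ℝ[X]) :
    BddAbove ((fun x => |sgn x - p.eval x|) '' (Icc (-A) (-1) ∪ Icc 1 B)) := by
  obtain ⟨M, hM⟩ := ((isCompact_Icc (a := -A) (b := -1)).union (isCompact_Icc (a := 1) (b := B))).bddAbove_image
    (f := fun x => |p.eval x|) (p.continuous.abs.continuousOn)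
  refine ⟨1 + M, ?_⟩
  rintro _ ⟨x, hx, rfl⟩
  have h1 : |p.eval x| ≤ M := hM ⟨x, hx, rfl⟩
  have h2 : |sgn x| ≤ 1 := by unfold sgn; split_ifs <;> norm_num
  have := abs_sub (sgn x) (p.eval x)
  simp only
  linarith

lemma lower_bound {A B : ℝ} (hA : 1 < A) (hB : 1 < B) : ∃ C₁ > 0, ∀ n : ℕ, 1 ≤ n →
    C₁ * (n:ℝ)^(-(1:ℝ)/2) * Real.exp (-(eta A B)*n) ≤ bestErr A B n := by
  obtain ⟨C₁, hC, h⟩ := lower_aux hA hB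
  refine ⟨C₁, hC, fun n hn => ?_⟩
  apply le_csInf
  · exact ⟨_, 0, by simp, rfl⟩
  · rintro e ⟨p, hp, rfl⟩
    apply le_of_forall_pos_le_add
    intro ε hε
    have hb := sgn_bdd A B p
    have h0 : 0 ≤ sSup ((fun x => |sgn x - p.eval x|) '' (Icc (-A) (-1) ∪ Icc 1 B)) := by
      apply Real.sSup_nonneg
      rintro _ ⟨x, _, rfl⟩
      exact abs_nonneg _
    refine h p n _ hn (by linarith) (natDegree_le_of_degree_le hp) ?_
    intro x hx
    have := le_csSup hb ⟨x, hx, rfl⟩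
    simp only at this
    linarith
end Fuchs

theorem fuchs_two_sided_bounds (A B : ℝ) (hA : 1 < A) (hB : 1 < B) :
    ∃ C₁ > (0 : ℝ), ∃ C₂ > (0 : ℝ), ∀ n : ℕ, 1 ≤ n →
      C₁ * (n : ℝ) ^ (-(1 : ℝ) / 2) * Real.exp (-(eta A B) * n) ≤ bestErr A B n ∧
      bestErr A B n ≤ C₂ * (n : ℝ) ^ (-(1 : ℝ) / 2) * Real.exp (-(eta A B) * n) := by
  obtain ⟨C₁, h1, hl⟩ := Fuchs.lower_bound hA hB
  obtain ⟨C₂, h2, hu⟩ := Fuchs.upper_bound hA hB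
  exact ⟨C₁, h1, C₂, h2, fun n hn => ⟨hl n hn, hu n hn⟩⟩
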